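/- For every p ∈ [1,2] there exists a constant C > 0, depending only on p, such that the following holds. Let ε ∈ (0,1], let ν_1, ν_2 be Lévy measures with σ̄_j²(ε) := ∫_{|x|≤ε} x² ν_j(dx) ∈ (0,∞), let σ_1, σ_2 ≥ 0 and t > 0, and for j = 1,2 let μ_t^j be the probability measure on ℝ with characteristic function u ↦ exp(t(−u²σ_j²/2 + ∫_{|x|≤ε} (e^{iux} − 1 − iux) ν_j(dx))) (the marginal at time t of the Lévy process with triplet (−∫_{ε<|x|≤1} x ν_j(dx), σ_j², ν_j·1_{[−ε,ε]})). Then W_p(μ_t^1, μ_t^2) ≤ Σ_{j=1}^2 C · min(√t · σ̄_j(ε), (∫_{|x|≤ε} |x|^{p+2} ν_j(dx) / σ̄_j²(ε))^{1/p}) + √t · |√(σ_1² + σ̄_1²(ε)) − √(σ_2² + σ̄_2²(ε))|. -/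

import Mathlib

open MeasureTheory ProbabilityTheory
open scoped ENNReal NNReal

/-- Wasserstein "distance" of order `p` with respect to a cost function `c`,
with values in `ℝ≥0∞`: the infimum over all couplings `π` of `μ` and `ν` of
`(∫ c(x,y)^p dπ)^(1/p)`. -/
noncomputable def wassersteinCost {E : Type*} [MeasurableSpace E]
    (c : E → E → ℝ) (p : ℝ) (μ ν : Measure E) : ℝ≥0∞ :=
  ⨅ π ∈ {π : Measure (E × E) |
      IsProbabilityMeasure π ∧ π.map Prod.fst = μ ∧ π.map Prod.snd = ν},
    (∫⁻ z, ENNReal.ofReal (c z.1 z.2) ^ p ∂π) ^ (1 / p)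

/-- Wasserstein distance of order `p` between measures on `ℝ` (usual metric). -/
noncomputable def wasserstein (p : ℝ) (μ ν : Measure ℝ) : ℝ≥0∞ :=
  wassersteinCost (fun x y => |x - y|) p μ ν

/-- Characteristic function of a measure on `ℝ`. -/
noncomputable def charFn (μ : Measure ℝ) (u : ℝ) : ℂ :=
  ∫ x, Complex.exp ((u * x : ℝ) * Complex.I) ∂μ

/-- Toscani–Fourier distance of order `s`, with values in `ℝ≥0∞`. -/
noncomputable def toscani (s : ℝ) (μ ν : Measure ℝ) : ℝ≥0∞ :=
  ⨆ u : {u : ℝ // u ≠ 0}, ENNReal.ofReal (‖charFn μ u.1 - charFn ν u.1‖ / |u.1| ^ s)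

/-- Total variation distance between two measures. -/
noncomputable def tvDist {α : Type*} [MeasurableSpace α] (μ ν : Measure α) : ℝ :=
  ⨆ A : {A : Set α // MeasurableSet A}, |(μ A.1).toReal - (ν A.1).toReal|

/-- Convolution of two measures on `ℝ`. -/
noncomputable def mconv (μ ν : Measure ℝ) : Measure ℝ :=
  (μ.prod ν).map (fun z => z.1 + z.2)

/-- The Poisson distribution with mean `lam`, as a measure on `ℕ`. -/
noncomputable def poissonNat (lam : ℝ) : Measure ℕ :=
  Measure.sum fun k : ℕ =>
    ENNReal.ofReal (Real.exp (-lam) * lam ^ k / (Nat.factorial k)) • Measure.dirac k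

/-- The Poisson distribution with mean `lam`, as a measure on `ℝ`. -/
noncomputable def poissonReal (lam : ℝ) : Measure ℝ :=
  Measure.sum fun k : ℕ =>
    ENNReal.ofReal (Real.exp (-lam) * lam ^ k / (Nat.factorial k)) • Measure.dirac (k : ℝ)

/-- `f'` is a weak derivative of `f` on `ℝ`. -/
def IsWeakDeriv (f f' : ℝ → ℝ) : Prop :=
  ∀ φ : ℝ → ℝ, ContDiff ℝ (⊤ : ℕ∞) φ → HasCompactSupport φ →
    ∫ x, f x * deriv φ x = -∫ x, f' x * φ x

/-- The integrand of the Lévy–Khintchine exponent with truncation `1`. -/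
noncomputable def lkIntegrand (u x : ℝ) : ℂ :=
  Complex.exp ((u * x : ℝ) * Complex.I) - 1 -
    (if |x| ≤ 1 then ((u * x : ℝ) : ℂ) * Complex.I else 0)

/-- The integrand of the Lévy–Khintchine exponent fully compensated (for small jumps). -/
noncomputable def lkIntegrandC (u x : ℝ) : ℂ :=
  Complex.exp ((u * x : ℝ) * Complex.I) - 1 - ((u * x : ℝ) : ℂ) * Complex.I



/-! ### Part 1: basic facts on the Wasserstein distance -/

lemma W_le_of_coupling {p : ℝ} {μ ν : Measure ℝ} (π : Measure (ℝ × ℝ)) (hπ : IsProbabilityMeasure π)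
    (h1 : π.map Prod.fst = μ) (h2 : π.map Prod.snd = ν) :
    wasserstein p μ ν ≤ (∫⁻ z, ENNReal.ofReal (|z.1 - z.2|) ^ p ∂π) ^ (1 / p) :=
  iInf₂_le (f := fun (π : Measure (ℝ × ℝ)) (_ : π ∈ {π : Measure (ℝ × ℝ) |
      IsProbabilityMeasure π ∧ π.map Prod.fst = μ ∧ π.map Prod.snd = ν}) =>
      (∫⁻ z, ENNReal.ofReal (|z.1 - z.2|) ^ p ∂π) ^ (1 / p)) π ⟨hπ, h1, h2⟩

lemma W_le_map {Ω : Type*} [MeasurableSpace Ω] {p : ℝ} (P : Measure Ω) [IsProbabilityMeasure P]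
    {X Y : Ω → ℝ} (hX : Measurable X) (hY : Measurable Y) :
    wasserstein p (P.map X) (P.map Y)
      ≤ (∫⁻ w, ENNReal.ofReal (|X w - Y w|) ^ p ∂P) ^ (1 / p) := by
  have hm : Measurable (fun w => (X w, Y w)) := hX.prodMk hY
  have := W_le_of_coupling (p := p) (μ := P.map X) (ν := P.map Y) (P.map (fun w => (X w, Y w)))
    (Measure.isProbabilityMeasure_map hm.aemeasurable)
    (by rw [Measure.map_map measurable_fst hm]; rfl)
    (by rw [Measure.map_map measurable_snd hm]; rfl)
  rwa [lintegral_map (by fun_prop) hm] at this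

lemma W_symm (p : ℝ) (μ ν : Measure ℝ) : wasserstein p μ ν ≤ wasserstein p ν μ := by
  refine le_iInf₂ fun π hπ => ?_
  obtain ⟨h0, h1, h2⟩ := hπ
  have h := W_le_map (p := p) π (X := Prod.snd) (Y := Prod.fst) measurable_snd measurable_fst
  rw [h1, h2] at h
  simpa only [abs_sub_comm] using h

lemma W_triangle {p : ℝ} (hp : 1 ≤ p) (μ1 μ2 μ3 : Measure ℝ) :
    wasserstein p μ1 μ3 ≤ wasserstein p μ1 μ2 + wasserstein p μ2 μ3 := by
  have key : ∀ π ∈ {π : Measure (ℝ × ℝ) |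
      IsProbabilityMeasure π ∧ π.map Prod.fst = μ1 ∧ π.map Prod.snd = μ2},
      ∀ ρ ∈ {π : Measure (ℝ × ℝ) |
      IsProbabilityMeasure π ∧ π.map Prod.fst = μ2 ∧ π.map Prod.snd = μ3},
      wasserstein p μ1 μ3 ≤ (∫⁻ z, ENNReal.ofReal (|z.1 - z.2|) ^ p ∂π) ^ (1 / p)
        + (∫⁻ z, ENNReal.ofReal (|z.1 - z.2|) ^ p ∂ρ) ^ (1 / p) := by
    rintro π ⟨h0, h1, h2⟩ ρ ⟨k0, k1, k2⟩
    let κ : Kernel (ℝ × ℝ) ℝ := ρ.condKernel.comap Prod.snd measurable_snd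
    let Q : Measure ((ℝ × ℝ) × ℝ) := π ⊗ₘ κ
    have hQ1 : Q.map Prod.fst = π := Measure.fst_compProd π κ
    have hQ2 : Q.map (fun w => (w.1.2, w.2)) = ρ := by
      have hd : ρ.fst ⊗ₘ ρ.condKernel = ρ := ρ.disintegrate ρ.condKernel
      have e : ρ.fst = π.map Prod.snd := by rw [h2]; exact k1
      refine Eq.trans ?_ hd
      rw [e]
      ext A hA
      rw [Measure.map_apply (by fun_prop) hA, Measure.compProd_apply hA,
        Measure.compProd_apply ((by fun_prop : Measurable (fun w : (ℝ×ℝ)×ℝ => (w.1.2, w.2))) hA),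
        lintegral_map (Kernel.measurable_kernel_prodMk_left hA) measurable_snd]
      rfl
    have t := W_le_map (p := p) Q (X := fun w => w.1.1) (Y := fun w => w.2)
      (by fun_prop) (by fun_prop)
    have e1 : Q.map (fun w => w.1.1) = μ1 := by
      rw [← h1, ← hQ1, Measure.map_map measurable_fst measurable_fst]; rfl
    have e2 : Q.map (fun w => w.2) = μ3 := by
      rw [← k2, ← hQ2, Measure.map_map measurable_snd (by fun_prop)]; rfl
    rw [e1, e2] at t
    refine t.trans ?_
    have e3 : ∫⁻ z, ENNReal.ofReal (|z.1 - z.2|) ^ p ∂π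
        = ∫⁻ w, ENNReal.ofReal (|w.1.1 - w.1.2|) ^ p ∂Q := by
      rw [← hQ1, lintegral_map (by fun_prop) measurable_fst]
    have e4 : ∫⁻ z, ENNReal.ofReal (|z.1 - z.2|) ^ p ∂ρ
        = ∫⁻ w, ENNReal.ofReal (|w.1.2 - w.2|) ^ p ∂Q := by
      rw [← hQ2, lintegral_map (by fun_prop) (by fun_prop)]
    rw [e3, e4]
    refine le_trans ?_ (ENNReal.lintegral_Lp_add_le (μ := Q)
      (f := fun w => ENNReal.ofReal (|w.1.1 - w.1.2|)) (g := fun w => ENNReal.ofReal (|w.1.2 - w.2|))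
      (by fun_prop) (by fun_prop) hp)
    gcongr with w
    simp only [Pi.add_apply]
    rw [← ENNReal.ofReal_add (abs_nonneg _) (abs_nonneg _)]
    exact ENNReal.ofReal_le_ofReal (abs_sub_le _ _ _)
  have : wasserstein p μ1 μ2 + wasserstein p μ2 μ3 = ⨅ ρ ∈ {π : Measure (ℝ × ℝ) |
      IsProbabilityMeasure π ∧ π.map Prod.fst = μ2 ∧ π.map Prod.snd = μ3},
      ⨅ π ∈ {π : Measure (ℝ × ℝ) |
      IsProbabilityMeasure π ∧ π.map Prod.fst = μ1 ∧ π.map Prod.snd = μ2},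
      ((∫⁻ z, ENNReal.ofReal (|z.1 - z.2|) ^ p ∂π) ^ (1 / p)
        + (∫⁻ z, ENNReal.ofReal (|z.1 - z.2|) ^ p ∂ρ) ^ (1 / p)) := by
    simp only [wasserstein, wassersteinCost, ENNReal.iInf_add, ENNReal.add_iInf]
  rw [this]
  exact le_iInf₂ fun ρ hρ => le_iInf₂ fun π hπ => key π hπ ρ hρ

lemma W_scale {p : ℝ} (hp : 1 ≤ p) {c : ℝ} (hc : c ≠ 0) (μ ν : Measure ℝ) :
    wasserstein p (μ.map (c * ·)) (ν.map (c * ·)) ≤ ENNReal.ofReal |c| * wasserstein p μ ν := by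
  have hp0 : 0 < p := by linarith
  have h0 : ENNReal.ofReal |c| ≠ 0 := by simpa using hc
  have hrhs : ENNReal.ofReal |c| * wasserstein p μ ν = ⨅ π ∈ {π : Measure (ℝ × ℝ) |
      IsProbabilityMeasure π ∧ π.map Prod.fst = μ ∧ π.map Prod.snd = ν},
      ENNReal.ofReal |c| * (∫⁻ z, ENNReal.ofReal (|z.1 - z.2|) ^ p ∂π) ^ (1 / p) := by
    simp only [wasserstein, wassersteinCost, ENNReal.mul_iInf_of_ne h0 ENNReal.ofReal_ne_top]
  rw [hrhs]
  refine le_iInf₂ fun π hπ => ?_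
  obtain ⟨k0, k1, k2⟩ := hπ
  have t := W_le_map (p := p) π (X := fun z => c * z.1) (Y := fun z => c * z.2)
    (by fun_prop) (by fun_prop)
  have e1 : π.map (fun z => c * z.1) = μ.map (c * ·) := by
    rw [← k1, Measure.map_map (by fun_prop) measurable_fst]; rfl
  have e2 : π.map (fun z => c * z.2) = ν.map (c * ·) := by
    rw [← k2, Measure.map_map (by fun_prop) measurable_snd]; rfl
  rw [e1, e2] at t
  refine t.trans (le_of_eq ?_)
  have : ∀ z : ℝ × ℝ, ENNReal.ofReal |c * z.1 - c * z.2| ^ p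
      = ENNReal.ofReal |c| ^ p * ENNReal.ofReal |z.1 - z.2| ^ p := by
    intro z
    rw [← mul_sub, abs_mul, ENNReal.ofReal_mul (abs_nonneg _), ENNReal.mul_rpow_of_nonneg _ _ hp0.le]
  simp only [this]
  rw [lintegral_const_mul _ (by fun_prop), ENNReal.mul_rpow_of_nonneg _ _ (by positivity),
    ← ENNReal.rpow_mul, mul_one_div_cancel hp0.ne', ENNReal.rpow_one]

lemma W_tv {p : ℝ} (hp : 1 ≤ p) (α a b : Measure ℝ) [IsProbabilityMeasure (α + a)]
    [IsProbabilityMeasure (α + b)] :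
    wasserstein p (α + a) (α + b)
      ≤ (2 ^ p * (∫⁻ x, ENNReal.ofReal |x| ^ p ∂a + ∫⁻ x, ENNReal.ofReal |x| ^ p ∂b)) ^ (1 / p) := by
  have hp0 : 0 < p := by linarith
  have ha : α Set.univ + a Set.univ = 1 := by
    rw [← Measure.add_apply]; exact measure_univ
  have hb : α Set.univ + b Set.univ = 1 := by
    rw [← Measure.add_apply]; exact measure_univ
  have hαt : α Set.univ ≠ ⊤ := fun h => by simp [h] at ha
  have hat : a Set.univ ≠ ⊤ := fun h => by simp [h] at ha
  have hbt : b Set.univ ≠ ⊤ := fun h => by simp [h] at hb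
  have hab : a Set.univ = b Set.univ := (ENNReal.add_right_inj hαt).1 (ha.trans hb.symm)
  have : IsFiniteMeasure a := ⟨lt_top_iff_ne_top.2 hat⟩
  have : IsFiniteMeasure b := ⟨lt_top_iff_ne_top.2 hbt⟩
  have : IsFiniteMeasure α := ⟨lt_top_iff_ne_top.2 hαt⟩
  set M := a Set.univ with hM
  have hd : Measurable (fun x : ℝ => (x, x)) := by fun_prop
  by_cases hM0 : M = 0
  · have a0 : a = 0 := Measure.measure_univ_eq_zero.1 (hM ▸ hM0)
    have b0 : b = 0 := Measure.measure_univ_eq_zero.1 (hab ▸ hM0)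
    subst a0 b0
    have t := W_le_map (p := p) (α + 0) (X := id) (Y := id) measurable_id measurable_id
    simp only [Measure.map_id] at t
    refine t.trans ?_
    simp [hp0]
  let π : Measure (ℝ × ℝ) := α.map (fun x => (x, x)) + M⁻¹ • a.prod b
  have h1 : π.map Prod.fst = α + a := by
    simp only [π]
    rw [Measure.map_add _ _ measurable_fst, Measure.map_map measurable_fst hd, Measure.map_smul,
      Measure.map_fst_prod, ← hab, smul_smul, ENNReal.inv_mul_cancel hM0 hat, one_smul]
    congr 1
    exact Measure.map_id
  have h2 : π.map Prod.snd = α + b := by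
    simp only [π]
    rw [Measure.map_add _ _ measurable_snd, Measure.map_map measurable_snd hd, Measure.map_smul,
      Measure.map_snd_prod, smul_smul, ENNReal.inv_mul_cancel hM0 hat, one_smul]
    congr 1
    exact Measure.map_id
  have h0 : IsProbabilityMeasure π := by
    constructor
    have : (π.map Prod.fst) Set.univ = 1 := by rw [h1]; exact measure_univ
    rwa [Measure.map_apply measurable_fst MeasurableSet.univ, Set.preimage_univ] at this
  refine (W_le_of_coupling (p := p) π h0 h1 h2).trans ?_
  refine ENNReal.rpow_le_rpow ?_ (by positivity)
  simp only [π]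
  rw [lintegral_add_measure, lintegral_map (by fun_prop) hd, lintegral_smul_measure]
  simp only [sub_self, abs_zero, ENNReal.ofReal_zero, ENNReal.zero_rpow_of_pos hp0, lintegral_zero,
    zero_add]
  have hpt : ∀ z : ℝ × ℝ, ENNReal.ofReal |z.1 - z.2| ^ p
      ≤ 2 ^ p * (ENNReal.ofReal |z.1| ^ p + ENNReal.ofReal |z.2| ^ p) := by
    intro z
    have : ENNReal.ofReal |z.1 - z.2| ≤ 2 * max (ENNReal.ofReal |z.1|) (ENNReal.ofReal |z.2|) := by
      calc ENNReal.ofReal |z.1 - z.2| ≤ ENNReal.ofReal (|z.1| + |z.2|) :=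
            ENNReal.ofReal_le_ofReal (abs_sub _ _)
        _ = ENNReal.ofReal |z.1| + ENNReal.ofReal |z.2| :=
            ENNReal.ofReal_add (abs_nonneg _) (abs_nonneg _)
        _ ≤ _ := by rw [two_mul]; exact add_le_add (le_max_left _ _) (le_max_right _ _)
    calc _ ≤ (2 * max (ENNReal.ofReal |z.1|) (ENNReal.ofReal |z.2|)) ^ p := by gcongr
      _ = 2 ^ p * (max (ENNReal.ofReal |z.1|) (ENNReal.ofReal |z.2|)) ^ p :=
          ENNReal.mul_rpow_of_nonneg _ _ hp0.le
      _ ≤ _ := by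
        gcongr
        rcases max_cases (ENNReal.ofReal |z.1|) (ENNReal.ofReal |z.2|) with h | h <;> rw [h.1]
        · exact le_self_add
        · exact le_add_self
  calc M⁻¹ • ∫⁻ z, ENNReal.ofReal |z.1 - z.2| ^ p ∂(a.prod b)
      ≤ M⁻¹ • ∫⁻ z, 2 ^ p * (ENNReal.ofReal |z.1| ^ p + ENNReal.ofReal |z.2| ^ p) ∂(a.prod b) := by
        gcongr with z; exact hpt z
    _ = 2 ^ p * (M⁻¹ * (M * ∫⁻ x, ENNReal.ofReal |x| ^ p ∂a + M * ∫⁻ x, ENNReal.ofReal |x| ^ p ∂b)) := by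
        rw [lintegral_const_mul _ (by fun_prop), lintegral_add_left (by fun_prop), smul_eq_mul]
        have i1 : ∫⁻ z, ENNReal.ofReal |z.1| ^ p ∂(a.prod b) = M * ∫⁻ x, ENNReal.ofReal |x| ^ p ∂a := by
          rw [lintegral_prod _ (by fun_prop)]
          simp [← hab, mul_comm]
          rw [lintegral_mul_const' _ _ hat]
        have i2 : ∫⁻ z, ENNReal.ofReal |z.2| ^ p ∂(a.prod b) = M * ∫⁻ x, ENNReal.ofReal |x| ^ p ∂b := by
          rw [lintegral_prod _ (by fun_prop)]
          simp [mul_comm, hM]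
        rw [i1, i2]; ring
    _ = _ := by rw [← mul_add, ← mul_assoc M⁻¹, ENNReal.inv_mul_cancel hM0 hat, one_mul]

lemma W_conv {p : ℝ} (μ G : Measure ℝ) [IsProbabilityMeasure μ] [IsProbabilityMeasure G] :
    wasserstein p μ (μ ∗ G) ≤ (∫⁻ x, ENNReal.ofReal |x| ^ p ∂G) ^ (1 / p) := by
  have t := W_le_map (p := p) (μ.prod G) (X := Prod.fst) (Y := fun z => z.1 + z.2)
    (by fun_prop) (by fun_prop)
  rw [Measure.map_fst_prod, measure_univ, one_smul] at t
  refine t.trans (le_of_eq ?_)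
  congr 1
  simp only [sub_add_cancel_left, abs_neg]
  rw [lintegral_prod _ (by fun_prop)]
  simp

/-- `L^p` cost bounded by `L²` cost, for `p ≤ 2`. -/
lemma lp_le_l2 {Ω : Type*} [MeasurableSpace Ω] {p : ℝ} (hp : 1 ≤ p) (hp2 : p ≤ 2)
    (P : Measure Ω) [IsProbabilityMeasure P] {X : Ω → ℝ} (hX : Measurable X) :
    (∫⁻ w, ENNReal.ofReal |X w| ^ p ∂P) ^ (1 / p)
      ≤ (∫⁻ w, ENNReal.ofReal (X w ^ 2) ∂P) ^ (1 / (2 : ℝ)) := by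
  have h := eLpNorm'_le_eLpNorm'_of_exponent_le (μ := P) (f := X) (p := p) (q := 2) (by linarith) hp2
    hX.aestronglyMeasurable
  simp only [eLpNorm'] at h
  convert h using 2
  · simp only [Real.enorm_eq_ofReal_abs]
  · congr 1; ext w
    rw [Real.enorm_eq_ofReal_abs]
    rw [← sq_abs, ENNReal.ofReal_pow (abs_nonneg _)]
    norm_num

lemma W_gauss {p : ℝ} (hp : 1 ≤ p) (hp2 : p ≤ 2) (a b : ℝ) :
    wasserstein p (gaussianReal 0 (Real.toNNReal (a ^ 2))) (gaussianReal 0 (Real.toNNReal (b ^ 2)))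
      ≤ ENNReal.ofReal |a - b| := by
  have e : ∀ c : ℝ, (gaussianReal 0 1).map (c * ·) = gaussianReal 0 (Real.toNNReal (c ^ 2)) := by
    intro c
    rw [gaussianReal_map_const_mul]
    congr 1
    · simp
    · rw [mul_one]; ext; simp; positivity
  rw [← e, ← e]
  refine (W_le_map (p := p) _ (by fun_prop) (by fun_prop)).trans ?_
  refine (lp_le_l2 hp hp2 (gaussianReal 0 1) (X := fun w => a * w - b * w) (by fun_prop)).trans ?_
  have h2 : ∫⁻ w, ENNReal.ofReal ((a * w - b * w) ^ 2) ∂(gaussianReal 0 1)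
      = ENNReal.ofReal ((a - b) ^ 2) := by
    have hi : Integrable (fun w : ℝ => w ^ 2) (gaussianReal 0 1) :=
      (memLp_id_gaussianReal 2).integrable_sq
    have hv : ∫ w, w ^ 2 ∂(gaussianReal 0 1) = 1 := by
      have := variance_id_gaussianReal (μ := 0) (v := 1)
      rw [variance_eq_integral (by fun_prop)] at this
      simpa using this
    have : ∀ w : ℝ, (a * w - b * w) ^ 2 = (a - b) ^ 2 * w ^ 2 := by intro w; ring
    simp only [this]
    rw [← ofReal_integral_eq_lintegral_ofReal (hi.const_mul _) (ae_of_all _ fun w => by positivity),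
      integral_const_mul, hv, mul_one]
  rw [h2, ENNReal.ofReal_rpow_of_nonneg (by positivity) (by positivity), ← Real.sqrt_eq_rpow,
    Real.sqrt_sq_eq_abs]


section Part2
open Filter Topology

lemma mv_bound {F F' : ℝ → ℂ} (hF : ∀ u, HasDerivAt F (F' u) u) (h0 : F 0 = 0)
    {A q : ℝ} (hA : 0 ≤ A) (hq : 0 ≤ q) (hb : ∀ u, ‖F' u‖ ≤ A * |u| ^ q) (u : ℝ) :
    ‖F u‖ ≤ A * |u| ^ (q + 1) := by
  have h := Convex.norm_image_sub_le_of_norm_hasDerivWithin_le (𝕜 := ℝ) (f := F) (f' := F')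
    (s := Set.uIcc 0 u) (C := A * |u| ^ q) (x := 0) (y := u)
    (fun x _ => (hF x).hasDerivWithinAt) (fun x hx => ?_) (convex_uIcc 0 u)
    Set.left_mem_uIcc Set.right_mem_uIcc
  · rw [h0, sub_zero, sub_zero, Real.norm_eq_abs] at h
    rcases eq_or_ne u 0 with rfl | hu
    · rw [h0]; simp; positivity
    · rw [Real.rpow_add_one (abs_ne_zero.2 hu)]
      linarith
  · refine (hb x).trans ?_
    have : |x| ≤ |u| := by
      have := Set.abs_sub_left_of_mem_uIcc hx
      simpa using this
    gcongr

lemma norm_cexp_sub_one_le (y : ℝ) : ‖Complex.exp (y * Complex.I) - 1‖ ≤ |y| := by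
  have := Real.norm_exp_I_mul_ofReal_sub_one_le (x := y)
  rw [mul_comm]; simpa using this

lemma norm_lk_le (u x : ℝ) : ‖lkIntegrandC u x‖ ≤ u ^ 2 * x ^ 2 := by
  have hd : ∀ v : ℝ, HasDerivAt (fun v => lkIntegrandC v x)
      ((x : ℂ) * Complex.I * (Complex.exp ((v * x : ℝ) * Complex.I) - 1)) v := by
    intro v
    unfold lkIntegrandC
    have h1 : HasDerivAt (fun v : ℝ => ((v * x : ℝ) : ℂ) * Complex.I) ((x : ℂ) * Complex.I) v := by
      have := ((hasDerivAt_id v).mul_const x).ofReal_comp.mul_const Complex.I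
      simpa using this
    convert! (h1.cexp.sub_const 1).sub h1 using 1
    ring
  have := mv_bound hd (by simp [lkIntegrandC]) (A := x ^ 2) (q := 1) (by positivity) (by norm_num)
    (fun v => ?_) u
  · norm_num at this
    linarith [mul_comm (u ^ 2) (x ^ 2)]
  · rw [norm_mul]
    have h1 := norm_cexp_sub_one_le (v * x)
    simp only [norm_mul, Complex.norm_real, Complex.norm_I, mul_one, Real.norm_eq_abs, Real.rpow_one]
    rw [abs_mul] at h1
    calc |x| * _ ≤ |x| * (|v| * |x|) := by gcongr
      _ = _ := by rw [← sq_abs x]; ring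

lemma continuous_lk_left (x : ℝ) : Continuous (fun u => lkIntegrandC u x) := by
  unfold lkIntegrandC; fun_prop

lemma continuous_lk_right (u : ℝ) : Continuous (fun x => lkIntegrandC u x) := by
  unfold lkIntegrandC; fun_prop

lemma integrable_lk {η : Measure ℝ} (h : Integrable (fun x => x ^ 2) η) (u : ℝ) :
    Integrable (fun x => lkIntegrandC u x) η :=
  (h.const_mul (u ^ 2)).mono' (continuous_lk_right u).aestronglyMeasurable
    (Filter.Eventually.of_forall fun x => norm_lk_le u x)

lemma norm_int_lk_le {η : Measure ℝ} (h : Integrable (fun x => x ^ 2) η) (u : ℝ) :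
    ‖∫ x, lkIntegrandC u x ∂η‖ ≤ u ^ 2 * ∫ x, x ^ 2 ∂η := by
  rw [← integral_const_mul]
  exact norm_integral_le_of_norm_le (h.const_mul (u ^ 2))
    (Filter.Eventually.of_forall fun x => norm_lk_le u x)

lemma levy_limit (P : ℕ → Measure ℝ) (hP : ∀ n, IsProbabilityMeasure (P n)) (φ : ℝ → ℂ)
    (hφ : ContinuousAt φ 0) (h : ∀ u, Tendsto (fun n => charFun (P n) u) atTop (𝓝 (φ u))) :
    ∃ J : Measure ℝ, IsProbabilityMeasure J ∧ ∀ u, charFun J u = φ u := by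
  have ht := isTightMeasureSet_of_tendsto_charFun hφ h
  let Q : ℕ → ProbabilityMeasure ℝ := fun n => ⟨P n, hP n⟩
  have hc : IsCompact (closure (Set.range Q)) := by
    apply isCompact_closure_of_isTightMeasureSet
    convert ht using 1
    ext m
    constructor
    · rintro ⟨_, ⟨n, rfl⟩, rfl⟩
      exact ⟨n, rfl⟩
    · rintro ⟨n, rfl⟩
      exact ⟨Q n, ⟨n, rfl⟩, rfl⟩
  obtain ⟨J, -, k, hk, hJ⟩ := hc.tendsto_subseq (x := Q) (fun n => subset_closure ⟨n, rfl⟩)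
  refine ⟨J, J.2, fun u => ?_⟩
  have h1 := (ProbabilityMeasure.tendsto_iff_tendsto_charFun.1 hJ) u
  have h2 := (h u).comp hk.tendsto_atTop
  exact tendsto_nhds_unique h1 h2

lemma conv_pow (P : Measure ℝ) [IsProbabilityMeasure P] (n : ℕ) :
    ∃ Q : Measure ℝ, IsProbabilityMeasure Q ∧ ∀ u, charFun Q u = charFun P u ^ n := by
  induction n with
  | zero => exact ⟨Measure.dirac 0, inferInstance, fun u => by simp [charFun_dirac]⟩
  | succ n ih =>
    obtain ⟨Q, hQ, h⟩ := ih
    exact ⟨Q ∗ P, inferInstance, fun u => by rw [charFun_conv, h, pow_succ]⟩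

lemma integrable_cexp (η : Measure ℝ) [IsFiniteMeasure η] (u : ℝ) :
    Integrable (fun x : ℝ => Complex.exp ((u * x : ℝ) * Complex.I)) η := by
  refine (integrable_const (1 : ℝ)).mono' (by fun_prop) (Filter.Eventually.of_forall fun x => ?_)
  rw [Complex.norm_exp_ofReal_mul_I]

lemma charFun_eq (η : Measure ℝ) (u : ℝ) :
    charFun η u = ∫ x, Complex.exp ((u * x : ℝ) * Complex.I) ∂η := by
  rw [charFun_apply_real]; simp

lemma ex_CP (η : Measure ℝ) [IsFiniteMeasure η] :
    ∃ J : Measure ℝ, IsProbabilityMeasure J ∧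
      ∀ u, charFun J u = Complex.exp (charFun η u - η.real Set.univ) := by
  set L := η.real Set.univ with hL
  have hL0 : 0 ≤ L := measureReal_nonneg
  obtain ⟨N, hN⟩ := exists_nat_gt L
  have hNpos : 0 < N := by
    have : (0 : ℝ) < N := lt_of_le_of_lt hL0 hN
    exact_mod_cast this
  let P : ℕ → Measure ℝ := fun n =>
    ENNReal.ofReal (1 - L / ((n + N : ℕ) : ℝ)) • Measure.dirac 0 +
      ENNReal.ofReal (1 / ((n + N : ℕ) : ℝ)) • η
  have hpos : ∀ n, (0 : ℝ) < ((n + N : ℕ) : ℝ) := fun n => by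
    have : 0 < n + N := by omega
    exact_mod_cast this
  have hle : ∀ n, L ≤ ((n + N : ℕ) : ℝ) := fun n => by push_cast; linarith [Nat.cast_nonneg (α := ℝ) n]
  have hfr : ∀ n, 0 ≤ 1 - L / ((n + N : ℕ) : ℝ) := fun n => by
    rw [sub_nonneg, div_le_one (hpos n)]; exact hle n
  have hP : ∀ n, IsProbabilityMeasure (P n) := fun n => by
    constructor
    simp only [P, Measure.add_apply, Measure.smul_apply, measure_univ, smul_eq_mul, mul_one]
    have : η Set.univ = ENNReal.ofReal L := by rw [hL]; simp [Measure.real]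
    rw [this, ← ENNReal.ofReal_mul (by positivity), ← ENNReal.ofReal_add (hfr n) (by positivity)]
    rw [← ENNReal.ofReal_one]; congr 1
    ring
  have hcf : ∀ n u, charFun (P n) u = 1 + (charFun η u - L) / ((n + N : ℕ) : ℂ) := by
    intro n u
    rw [charFun_eq, integral_add_measure, integral_smul_measure, integral_smul_measure,
      ← charFun_eq η, integral_dirac, ENNReal.toReal_ofReal (hfr n), ENNReal.toReal_ofReal (by positivity)]
    · simp only [mul_zero, Complex.ofReal_zero, zero_mul, Complex.exp_zero, Complex.real_smul]
      push_cast
      ring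
    · exact (integrable_cexp _ u).smul_measure ENNReal.ofReal_ne_top
    · exact (integrable_cexp _ u).smul_measure ENNReal.ofReal_ne_top
  have := fun n => conv_pow (P n) (n + N)
  choose Q hQ hQc using this
  refine levy_limit Q hQ (fun u => Complex.exp (charFun η u - L)) ?_ ?_
  · have : Continuous (charFun η) := continuous_charFun
    fun_prop
  · intro u
    simp_rw [hQc, hcf]
    exact (Complex.tendsto_one_add_div_pow_exp (charFun η u - L)).comp (tendsto_add_atTop_nat N)

lemma ex_J_fin (η : Measure ℝ) [IsFiniteMeasure η] (hi : Integrable (fun x : ℝ => x) η) :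
    ∃ J : Measure ℝ, IsProbabilityMeasure J ∧
      ∀ u, charFun J u = Complex.exp (∫ x, lkIntegrandC u x ∂η) := by
  obtain ⟨J, hJ, hc⟩ := ex_CP η
  refine ⟨J.map (fun x => x + (-∫ x, x ∂η)), Measure.isProbabilityMeasure_map (by fun_prop), fun u => ?_⟩
  rw [charFun_map_add_const, hc, ← Complex.exp_add]
  congr 1
  have h1 : ∫ x, lkIntegrandC u x ∂η = charFun η u - η.real Set.univ -
      u * (∫ x, x ∂η : ℝ) * Complex.I := by
    unfold lkIntegrandC
    have i3 : Integrable (fun x : ℝ => ((u * x : ℝ) : ℂ) * Complex.I) η :=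
      ((hi.const_mul u).ofReal).mul_const Complex.I
    have i12 : Integrable (fun x : ℝ => Complex.exp ((u * x : ℝ) * Complex.I) - 1) η :=
      (integrable_cexp η u).sub (integrable_const _)
    rw [integral_sub i12 i3,
      integral_sub (integrable_cexp η u) (integrable_const _), charFun_eq, integral_mul_const,
      integral_complex_ofReal, integral_const_mul]
    simp
  rw [h1]
  simp
  ring

lemma ex_J (η : Measure ℝ) (h : Integrable (fun x => x ^ 2) η) :
    ∃ J : Measure ℝ, IsProbabilityMeasure J ∧
      ∀ u, charFun J u = Complex.exp (∫ x, lkIntegrandC u x ∂η) := by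
  let S : ℕ → Set ℝ := fun n => {x | 1 < ((n : ℝ) + 1) * |x|}
  have hS : ∀ n, MeasurableSet (S n) := fun n =>
    measurableSet_lt measurable_const (by fun_prop)
  have hfin : ∀ n, IsFiniteMeasure (η.restrict (S n)) := fun n => by
    have hI : Integrable (fun _ : ℝ => (1 : ℝ)) (η.restrict (S n)) := by
      refine ((h.restrict (s := S n)).const_mul (((n : ℝ) + 1) ^ 2)).mono' (by fun_prop) ?_
      filter_upwards [ae_restrict_mem (hS n)] with x hx
      have : (1 : ℝ) < ((n : ℝ) + 1) * |x| := hx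
      rw [← sq_abs x, ← mul_pow, norm_one]
      nlinarith
    rcases integrable_const_iff.1 hI with h | h
    · norm_num at h
    · exact h
  have hid : ∀ n, Integrable (fun x : ℝ => x) (η.restrict (S n)) := fun n => by
      refine ((h.restrict (s := S n)).const_mul ((n : ℝ) + 1)).mono' (by fun_prop) ?_
      filter_upwards [ae_restrict_mem (hS n)] with x hx
      have : (1 : ℝ) < ((n : ℝ) + 1) * |x| := hx
      rw [← sq_abs x, Real.norm_eq_abs]
      nlinarith [abs_nonneg x]
  have := fun n => ex_J_fin (η.restrict (S n)) (hid n)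
  choose Q hQ hQc using this
  refine levy_limit Q hQ _ ?_ ?_
  · apply Continuous.continuousAt
    refine Complex.continuous_exp.comp ?_
    rw [continuous_iff_continuousAt]
    intro u
    refine continuousAt_of_dominated (bound := fun x => (|u| + 1) ^ 2 * x ^ 2)
      (Eventually.of_forall fun v => (continuous_lk_right v).aestronglyMeasurable) ?_
      (h.const_mul _) (Eventually.of_forall fun x => (continuous_lk_left x).continuousAt)
    filter_upwards [Metric.ball_mem_nhds u one_pos] with v hv
    refine Eventually.of_forall fun x => (norm_lk_le v x).trans ?_
    have : |v| ≤ |u| + 1 := by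
      rw [Metric.mem_ball, Real.dist_eq] at hv
      linarith [abs_sub_abs_le_abs_sub v u]
    rw [← sq_abs v]
    gcongr
  · intro u
    simp_rw [hQc]
    refine (Complex.continuous_exp.tendsto _).comp ?_
    have : ∀ n, ∫ x, lkIntegrandC u x ∂(η.restrict (S n)) =
        ∫ x, (S n).indicator (fun x => lkIntegrandC u x) x ∂η := fun n =>
      (integral_indicator (hS n)).symm
    simp_rw [this]
    refine tendsto_integral_of_dominated_convergence (fun x => u ^ 2 * x ^ 2)
      (fun n => ((continuous_lk_right u).aestronglyMeasurable).indicator (hS n)) (h.const_mul _) ?_ ?_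
    · intro n
      refine Eventually.of_forall fun x => (norm_indicator_le_norm_self _ _).trans (norm_lk_le u x)
    · refine Eventually.of_forall fun x => ?_
      rcases eq_or_ne x 0 with rfl | hx
      · have : lkIntegrandC u 0 = 0 := by simp [lkIntegrandC]
        simp [Set.indicator, this]
      · refine tendsto_const_nhds.congr' ?_
        have ht : Tendsto (fun n : ℕ => ((n : ℝ) + 1) * |x|) atTop atTop :=
          (tendsto_natCast_atTop_atTop.atTop_add tendsto_const_nhds).atTop_mul_const (abs_pos.2 hx)
        filter_upwards [ht.eventually_gt_atTop 1] with n hn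
        rw [Set.indicator_of_mem]
        exact hn

lemma second_moment (J : Measure ℝ) [IsProbabilityMeasure J] (V : ℝ) (z : ℝ → ℂ)
    (hz : ∀ u, ‖z u‖ ≤ u ^ 2 * V) (hJ : ∀ u, charFun J u = Complex.exp (z u)) :
    ∫⁻ x, ENNReal.ofReal (x ^ 2) ∂J ≤ ENNReal.ofReal (4 * V) := by
  have hV : 0 ≤ V := by have := (norm_nonneg _).trans (hz 1); simpa using this
  let h : ℕ → ℝ := fun n => 1 / ((n : ℝ) + 1)
  have hpos : ∀ n, 0 < h n := fun n => by positivity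
  have hlim : Tendsto h atTop (𝓝 0) := tendsto_one_div_add_atTop_nhds_zero_nat
  let f : ℕ → ℝ → ℝ := fun n x => 2 * (1 - Real.cos (h n * x)) / (h n) ^ 2
  have hf : ∀ x, Tendsto (fun n => f n x) atTop (𝓝 (x ^ 2)) := by
    intro x
    have h1 : Tendsto (fun n => 4 * (Real.sinc (h n * x / 2) * (x / 2)) ^ 2) atTop
        (𝓝 (4 * (Real.sinc (0 * x / 2) * (x / 2)) ^ 2)) := by
      have := (Real.continuous_sinc.tendsto (0 * x / 2)).comp ((hlim.mul_const x).div_const 2)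
      exact ((this.mul_const _).pow 2).const_mul 4
    have e : 4 * (Real.sinc (0 * x / 2) * (x / 2)) ^ 2 = x ^ 2 := by simp; ring
    rw [e] at h1
    refine h1.congr fun n => ?_
    have hh := (hpos n).ne'
    simp only [f]
    rcases eq_or_ne x 0 with rfl | hx
    · simp
    · rw [Real.sinc_of_ne_zero (by positivity)]
      have : Real.cos (h n * x) = 1 - 2 * Real.sin (h n * x / 2) ^ 2 := by
        have := Real.cos_two_mul (h n * x / 2)
        rw [show 2 * (h n * x / 2) = h n * x by ring] at this
        have h3 := Real.sin_sq_add_cos_sq (h n * x / 2)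
        linarith
      rw [this]
      field_simp
      try ring
  have hfi : ∀ᶠ m in atTop, ∫⁻ x, ENNReal.ofReal (f m x) ∂J ≤ ENNReal.ofReal (4 * V) := by
    have hsm : Tendsto (fun m => (h m) ^ 2 * V) atTop (𝓝 0) := by
      simpa using (hlim.pow 2).mul_const V
    filter_upwards [hsm.eventually_le_const one_pos] with m hm
    have hz1 : ‖z (h m)‖ ≤ 1 := (hz _).trans hm
    have hint : Integrable (fun x => Real.cos (h m * x)) J := by
      refine (integrable_const (1 : ℝ)).mono' (by fun_prop) (Eventually.of_forall fun x => ?_)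
      exact Real.abs_cos_le_one _
    have hre : ∫ x, Real.cos (h m * x) ∂J = (charFun J (h m)).re := by
      rw [charFun_eq]
      have := integral_re (𝕜 := ℂ) (integrable_cexp J (h m))
      simp only [RCLike.re_eq_complex_re] at this
      rw [← this]
      simp only [Complex.exp_ofReal_mul_I_re]
    rw [← ofReal_integral_eq_lintegral_ofReal]
    · apply ENNReal.ofReal_le_ofReal
      simp only [f]
      rw [integral_div, integral_const_mul, integral_sub (integrable_const _) hint, hre]
      have h2 : 1 - (charFun J (h m)).re ≤ 2 * (h m ^ 2 * V) := by
        have a := Complex.norm_exp_sub_one_le hz1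
        have b := Complex.abs_re_le_norm (Complex.exp (z (h m)) - 1)
        rw [← hJ] at a b
        simp only [Complex.sub_re, Complex.one_re] at b
        have := neg_abs_le ((charFun J (h m)).re - 1)
        linarith [hz (h m)]
      rw [div_le_iff₀ (pow_pos (hpos m) 2)]
      simp
      linarith
    · exact (((integrable_const _).sub hint).const_mul 2).div_const _
    · refine Eventually.of_forall fun x => ?_
      have := Real.cos_le_one (h m * x)
      have := hpos m
      simp only [f, Pi.zero_apply]
      apply div_nonneg _ (by positivity)
      linarith
  calc ∫⁻ x, ENNReal.ofReal (x ^ 2) ∂J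
      = ∫⁻ x, liminf (fun n => ENNReal.ofReal (f n x)) atTop ∂J := by
        congr 1; ext x
        exact ((ENNReal.tendsto_ofReal (hf x)).liminf_eq).symm
    _ ≤ liminf (fun n => ∫⁻ x, ENNReal.ofReal (f n x) ∂J) atTop :=
        lintegral_liminf_le fun n => by simp only [f]; fun_prop
    _ ≤ ENNReal.ofReal (4 * V) := by
        refine (liminf_le_liminf hfi).trans ?_
        simp

end Part2


section Part3
open Filter Topology
open scoped FourierTransform ContDiff SchwartzMap Convolution

lemma fourier_moment (p : ℝ) (hp1 : 1 ≤ p) (hp2 : p ≤ 2) (F F1 F2 F3 : ℝ → ℂ)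
    (hF : ContDiff ℝ ∞ F) (hs : HasCompactSupport F)
    (h1 : ∀ v, HasDerivAt F (F1 v) v) (h2 : ∀ v, HasDerivAt F1 (F2 v) v)
    (h3 : ∀ v, HasDerivAt F2 (F3 v) v) (B : ℝ) (hB : 0 < B)
    (hb0 : ∫ v, ‖F v‖ ^ 2 ≤ B ^ 2) (hb3 : ∫ v, ‖F3 v‖ ^ 2 ≤ B ^ 2) :
    ∫⁻ x, ENNReal.ofReal |x| ^ p * ENNReal.ofReal ‖𝓕 F x‖ ≤ ENNReal.ofReal (5 * B) := by
  have e1 : deriv F = F1 := funext fun v => (h1 v).deriv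
  have e2 : deriv F1 = F2 := funext fun v => (h2 v).deriv
  have e3 : deriv F2 = F3 := funext fun v => (h3 v).deriv
  have c1 : ContDiff ℝ ∞ F1 := e1 ▸ ((contDiff_infty_iff_deriv (𝕜 := ℝ)).1 hF).2
  have c2 : ContDiff ℝ ∞ F2 := e2 ▸ ((contDiff_infty_iff_deriv (𝕜 := ℝ)).1 c1).2
  have c3 : ContDiff ℝ ∞ F3 := e3 ▸ ((contDiff_infty_iff_deriv (𝕜 := ℝ)).1 c2).2
  have s1 : HasCompactSupport F1 := e1 ▸ hs.deriv
  have s2 : HasCompactSupport F2 := e2 ▸ s1.deriv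
  have s3 : HasCompactSupport F3 := e3 ▸ s2.deriv
  have i0 := hF.continuous.integrable_of_hasCompactSupport hs (μ := volume)
  have i1 := c1.continuous.integrable_of_hasCompactSupport s1 (μ := volume)
  have i2 := c2.continuous.integrable_of_hasCompactSupport s2 (μ := volume)
  have i3 := c3.continuous.integrable_of_hasCompactSupport s3 (μ := volume)
  have k1 := Real.fourier_deriv i0 (hF.differentiable (by simp)) (e1 ▸ i1)
  have k2 := Real.fourier_deriv i1 (c1.differentiable (by simp)) (e2 ▸ i2)
  have k3 := Real.fourier_deriv i2 (c2.differentiable (by simp)) (e3 ▸ i3)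
  rw [e1] at k1; rw [e2] at k2; rw [e3] at k3
  let f0 : 𝓢(ℝ, ℂ) := hs.toSchwartzMap hF
  let f3 : 𝓢(ℝ, ℂ) := s3.toSchwartzMap c3
  have P0 : ∫ x, ‖𝓕 F x‖ ^ 2 = ∫ v, ‖F v‖ ^ 2 := SchwartzMap.integral_norm_sq_fourier f0
  have P3 : ∫ x, ‖𝓕 F3 x‖ ^ 2 = ∫ v, ‖F3 v‖ ^ 2 := SchwartzMap.integral_norm_sq_fourier f3
  have sqi : ∀ f : 𝓢(ℝ, ℂ), Integrable (fun x => ‖f x‖ ^ 2) := fun f =>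
    (memLp_two_iff_integrable_sq_norm f.continuous.aestronglyMeasurable).1 (f.memLp 2)
  have I0 : Integrable (fun x => ‖𝓕 F x‖ ^ 2) := sqi (𝓕 f0)
  have I3 : Integrable (fun x => ‖𝓕 F3 x‖ ^ 2) := sqi (𝓕 f3)
  have hc : Continuous (𝓕 F) := (𝓕 f0).continuous
  have hn3 : ∀ x, x ^ 6 * ‖𝓕 F x‖ ^ 2 ≤ ‖𝓕 F3 x‖ ^ 2 := by
    intro x
    rw [k3, k2, k1]
    simp only [smul_eq_mul, norm_mul, Complex.norm_real, Complex.norm_I, mul_one, Complex.norm_ofNat,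
      Real.norm_eq_abs]
    have : 1 ≤ 2 * |Real.pi| := by rw [abs_of_pos Real.pi_pos]; linarith [Real.pi_gt_three]
    have h6 : x ^ 6 = (|x| ^ 3) ^ 2 := by rw [← abs_pow, sq_abs]; ring
    rw [h6, ← mul_pow]
    have : |x| ≤ 2 * |Real.pi| * |x| := by nlinarith [abs_nonneg x]
    apply pow_le_pow_left₀ (by positivity)
    calc |x| ^ 3 * ‖𝓕 F x‖ = |x| * (|x| * (|x| * ‖𝓕 F x‖)) := by ring
      _ ≤ _ := by gcongr
  let D : ℝ → ℝ := fun x => 1 / (2 * B) * (‖𝓕 F x‖ ^ 2 + ‖𝓕 F3 x‖ ^ 2) + B * (1 + x ^ 2)⁻¹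
  have hD : Integrable D := ((I0.add I3).const_mul _).add (integrable_inv_one_add_sq.const_mul _)
  have hpt : ∀ x, |x| ^ p * ‖𝓕 F x‖ ≤ D x := by
    intro x
    set d := ‖𝓕 F x‖ with hd
    have hd0 : 0 ≤ d := norm_nonneg _
    have hxp : (|x| ^ p) ^ 2 ≤ 1 + x ^ 4 := by
      rw [← Real.rpow_natCast, ← Real.rpow_mul (abs_nonneg x)]
      rcases le_total |x| 1 with h | h
      · have := Real.rpow_le_one (abs_nonneg x) h (z := p * (2 : ℕ)) (by positivity)
        nlinarith [sq_nonneg (x ^ 2)]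
      · have := Real.rpow_le_rpow_of_exponent_le h (y := p * (2 : ℕ)) (z := (4 : ℕ))
          (by push_cast; linarith)
        rw [Real.rpow_natCast] at this
        have h4 : |x| ^ 4 = x ^ 4 := by rw [← abs_pow, abs_of_nonneg (by positivity)]
        linarith
    have hw : (1 + x ^ 4) * (1 + x ^ 2) ≤ 2 * (1 + x ^ 6) := by
      nlinarith [mul_nonneg (sq_nonneg (1 - x ^ 2)) (by positivity : (0:ℝ) ≤ 1 + x ^ 2)]
    set A := |x| ^ p
    have hA : 0 ≤ A := by positivity
    set W := (1 + x ^ 2)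
    have hW : 0 < W := by positivity
    have key : A * d ≤ 1 / (2 * B) * (d ^ 2 + x ^ 6 * d ^ 2) + B * W⁻¹ := by
      have hAW : A ^ 2 * W ≤ 2 * (1 + x ^ 6) := le_trans (by gcongr) hw
      -- 2 B * W * A * d ≤ W d^2 (1+x^6) + 2 B^2
      have h5 : 2 * B * W * (A * d) ≤ W * (d ^ 2 * (1 + x ^ 6)) + 2 * B ^ 2 := by
        have : W * (d ^ 2 * (A ^ 2 * W / 2)) ≤ W * (d ^ 2 * (1 + x ^ 6)) := by
          gcongr; linarith
        nlinarith [sq_nonneg (W * A * d - 2 * B)]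
      have : 1 / (2 * B) * (d ^ 2 + x ^ 6 * d ^ 2) + B * W⁻¹ - A * d =
          (W * (d ^ 2 * (1 + x ^ 6)) + 2 * B ^ 2 - 2 * B * W * (A * d)) / (2 * B * W) := by
        field_simp
      have h7 : 0 ≤ (W * (d ^ 2 * (1 + x ^ 6)) + 2 * B ^ 2 - 2 * B * W * (A * d)) / (2 * B * W) :=
        div_nonneg (by linarith) (by positivity)
      linarith
    refine key.trans ?_
    simp only [D]
    gcongr
    exact hn3 x
  calc ∫⁻ x, ENNReal.ofReal |x| ^ p * ENNReal.ofReal ‖𝓕 F x‖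
      ≤ ∫⁻ x, ENNReal.ofReal (D x) := by
        apply lintegral_mono
        intro x
        simp only
        rw [ENNReal.ofReal_rpow_of_nonneg (abs_nonneg x) (by linarith),
          ← ENNReal.ofReal_mul (by positivity)]
        exact ENNReal.ofReal_le_ofReal (hpt x)
    _ = ENNReal.ofReal (∫ x, D x) := by
        rw [ofReal_integral_eq_lintegral_ofReal hD]
        refine Eventually.of_forall fun x => ?_
        simp only [D, Pi.zero_apply]; positivity
    _ ≤ ENNReal.ofReal (5 * B) := by
        apply ENNReal.ofReal_le_ofReal
        simp only [D]
        have I03 : Integrable (fun x => 1 / (2 * B) * (‖𝓕 F x‖ ^ 2 + ‖𝓕 F3 x‖ ^ 2)) :=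
          (I0.add I3).const_mul _
        rw [integral_add I03 (integrable_inv_one_add_sq.const_mul _),
          integral_const_mul, integral_const_mul, integral_add I0 I3, P0, P3,
          integral_univ_inv_one_add_sq]
        have : 1 / (2 * B) * ((∫ v, ‖F v‖ ^ 2) + ∫ v, ‖F3 v‖ ^ 2) ≤ 1 / (2 * B) * (B ^ 2 + B ^ 2) := by
          gcongr
        have e : 1 / (2 * B) * (B ^ 2 + B ^ 2) = B := by field_simp; ring
        nlinarith [Real.pi_lt_four]

lemma ex_kernel : ∃ (g : ℝ → ℂ) (k : ℝ → ℝ), ContDiff ℝ ∞ g ∧ HasCompactSupport g ∧ g 0 = 1 ∧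
    (∀ x, 0 ≤ k x) ∧ Continuous k ∧ (∀ x, 𝓕 g x = (k x : ℂ)) ∧ Integrable k ∧ ∫ x, k x = 1 ∧
    Integrable (fun x => x ^ 2 * k x) := by
  let b : ContDiffBump (0 : ℝ) := ⟨1, 2, by norm_num, by norm_num⟩
  let f : ℝ → ℂ := fun x => ((b x : ℝ) : ℂ)
  have hf : ContDiff ℝ ∞ f := Complex.ofRealCLM.contDiff.comp b.contDiff
  have hs : HasCompactSupport f := b.hasCompactSupport.comp_left (g := fun x : ℝ => (x : ℂ)) (by simp)
  let F : 𝓢(ℝ, ℂ) := hs.toSchwartzMap hf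
  let L := ContinuousLinearMap.mul ℂ ℂ
  let G0 : 𝓢(ℝ, ℂ) := SchwartzMap.convolution L F F
  have hreal : ∀ x, (𝓕 F x).im = 0 := by
    intro x
    rw [SchwartzMap.fourier_coe, ← Complex.conj_eq_iff_im, Real.fourier_real_eq_integral_exp_smul,
      ← integral_conj, ← integral_neg_eq_self]
    congr 1; ext v
    have hv : F (-v) = F v := by
      show ((b (-v) : ℝ) : ℂ) = ((b v : ℝ) : ℂ)
      rw [b.neg]
    have hcj : (starRingEnd ℂ) (F v) = F v := Complex.conj_ofReal _
    rw [smul_eq_mul, smul_eq_mul, map_mul, hv, hcj, ← Complex.exp_conj]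
    simp only [map_mul, Complex.conj_ofReal, Complex.conj_I]
    push_cast; ring_nf
  have hG0 : ∀ x, 𝓕 G0 x = (((𝓕 F x).re ^ 2 : ℝ) : ℂ) := by
    intro x
    have : 𝓕 G0 x = 𝓕 F x * 𝓕 F x := by
      simp only [G0, SchwartzMap.fourier_convolution]; rfl
    rw [this]
    apply Complex.ext
    · simp [hreal x, sq]
    · rw [Complex.mul_im, hreal x, Complex.ofReal_im]; ring
  have happ : ∀ x, G0 x = (f ⋆[L] f) x := fun x => SchwartzMap.convolution_apply L F F x
  have hcs : HasCompactSupport (G0 : ℝ → ℂ) := by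
    have : (G0 : ℝ → ℂ) = (f ⋆[L] f) := funext happ
    rw [this]; exact hs.convolution L hs
  -- value at zero
  set Z : ℝ := ∫ v, (b v) ^ 2 with hZ
  have hG00 : G0 0 = (Z : ℂ) := by
    rw [happ, convolution_def, hZ, ← integral_complex_ofReal]
    congr 1; ext v
    simp only [L, ContinuousLinearMap.mul_apply', zero_sub, f, b.neg]
    push_cast; ring
  have hZpos : 0 < Z := by
    have hcont : Continuous (fun v => (b v) ^ 2) := b.continuous.pow 2
    rw [hZ]
    apply hcont.integral_pos_of_hasCompactSupport_nonneg_nonzero (x := 0)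
    · exact b.hasCompactSupport.comp_left (g := fun x : ℝ => x ^ 2) (by simp)
    · intro x; positivity
    · have : b 0 = 1 := b.one_of_mem_closedBall (by simp; norm_num)
      rw [this]; norm_num
  let g : 𝓢(ℝ, ℂ) := ((Z⁻¹ : ℝ) : ℂ) • G0
  let k : ℝ → ℝ := fun x => Z⁻¹ * (𝓕 F x).re ^ 2
  have hk : ∀ x, 𝓕 (g : ℝ → ℂ) x = (k x : ℂ) := by
    intro x
    rw [← SchwartzMap.fourier_coe]
    simp only [g, k, FourierTransform.fourier_smul, smul_apply, hG0, smul_eq_mul]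
    push_cast; ring
  have hkn : ∀ x, ‖(𝓕 g) x‖ = k x := fun x => by
    rw [SchwartzMap.fourier_coe, hk, Complex.norm_real, Real.norm_of_nonneg]
    simp only [k]; positivity
  have hk0 : ∀ x, 0 ≤ k x := fun x => by rw [← hkn]; exact norm_nonneg _
  have hkc : Continuous k := by
    have : k = fun x => ‖(𝓕 g) x‖ := funext fun x => (hkn x).symm
    rw [this]; exact (𝓕 g).continuous.norm
  have hki : Integrable k := by
    have : k = fun x => ‖(𝓕 g) x‖ := funext fun x => (hkn x).symm
    rw [this]; exact (𝓕 g).integrable.norm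
  have hg0 : g 0 = 1 := by
    have hz : (Z : ℂ) ≠ 0 := by exact_mod_cast hZpos.ne'
    simp only [g, smul_apply, hG00, smul_eq_mul]
    push_cast
    exact inv_mul_cancel₀ hz
  refine ⟨g, k, g.smooth ⊤, ?_, hg0, hk0, hkc, hk, hki, ?_, ?_⟩
  · have : (g : ℝ → ℂ) = fun x => ((Z⁻¹ : ℝ) : ℂ) • G0 x := rfl
    rw [this]
    exact hcs.comp_left (g := fun z : ℂ => ((Z⁻¹ : ℝ) : ℂ) • z) (by simp)
  · have h1 : 𝓕⁻ (𝓕 g) = g := FourierTransform.fourierInv_fourier_eq g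
    have h2 : (𝓕⁻ (𝓕 g)) 0 = 1 := by rw [h1, hg0]
    rw [SchwartzMap.fourierInv_coe, Real.fourierInv_eq'] at h2
    have h3 : ∫ x, ((k x : ℝ) : ℂ) = 1 := by
      rw [← h2]; congr 1; ext x
      rw [SchwartzMap.fourier_coe, hk]; simp
    rw [integral_complex_ofReal] at h3
    exact_mod_cast h3
  · have := (𝓕 g).integrable_pow_mul volume 2
    simpa [hkn] using this

end Part3


section Part4
open Filter Topology
open scoped FourierTransform ContDiff Convolution

lemma integrable_cf_mul (μ : Measure ℝ) [IsProbabilityMeasure μ] (g : ℝ → ℂ) (hg : Integrable g) :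
    Integrable (fun v => charFun μ (2 * Real.pi * v) * g v) := by
  refine hg.norm.mono' ?_ (Eventually.of_forall fun v => ?_)
  · have : Continuous (charFun μ) := continuous_charFun
    exact (by fun_prop : Continuous fun v : ℝ => charFun μ (2 * Real.pi * v)).aestronglyMeasurable.mul hg.1
  · rw [norm_mul]
    have := norm_charFun_le_one (μ := μ) (2 * Real.pi * v)
    nlinarith [norm_nonneg (g v)]

lemma fourier_cf_mul (μ : Measure ℝ) [IsProbabilityMeasure μ] (g : ℝ → ℂ) (hg : Integrable g)
    (hgc : Continuous g) (x : ℝ) :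
    𝓕 (fun v => charFun μ (2 * Real.pi * v) * g v) x = ∫ y, 𝓕 g (x - y) ∂μ := by
  simp_rw [Real.fourier_real_eq_integral_exp_smul]
  rw [integral_integral_swap]
  · congr 1; ext v
    rw [charFun_eq, ← integral_mul_const, ← integral_smul]
    congr 1; ext y
    simp only [smul_eq_mul]
    rw [← mul_assoc, ← Complex.exp_add]
    congr 2
    push_cast; ring
  · have : Integrable (fun z : ℝ × ℝ => g z.2) (μ.prod volume) := hg.comp_snd μ
    refine this.norm.mono' ?_ (Eventually.of_forall fun z => ?_)
    · exact Continuous.aestronglyMeasurable (by simp only [Function.uncurry_def]; fun_prop)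
    · simp only [Function.uncurry_def, norm_smul]
      rw [Complex.norm_exp_ofReal_mul_I, one_mul]

lemma smooth_density (μ : Measure ℝ) [IsProbabilityMeasure μ] (g : ℝ → ℂ) (k : ℝ → ℝ)
    (hg : Integrable g) (hgc : Continuous g) (hk0 : ∀ x, 0 ≤ k x) (hkc : Continuous k)
    (hk : ∀ x, 𝓕 g x = (k x : ℂ)) :
    μ ∗ (volume.withDensity fun x => ENNReal.ofReal (k x)) = volume.withDensity
      (fun x => ENNReal.ofReal (𝓕 (fun v => charFun μ (2 * Real.pi * v) * g v) x).re) := by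
  have hkm : Measurable (fun x => ENNReal.ofReal (k x)) := by fun_prop
  have hbd : ∀ x, k x ≤ ∫ v, ‖g v‖ := fun x => by
    have h := hk x
    have : ‖𝓕 g x‖ ≤ ∫ v, ‖g v‖ := VectorFourier.norm_fourierIntegral_le_integral_norm _ _ _ _ _
    rw [h, Complex.norm_real, Real.norm_of_nonneg (hk0 x)] at this
    exact this
  have hden : ∀ x, ENNReal.ofReal (𝓕 (fun v => charFun μ (2 * Real.pi * v) * g v) x).re =
      ∫⁻ y, ENNReal.ofReal (k (x - y)) ∂μ := by
    intro x
    rw [fourier_cf_mul μ g hg hgc]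
    simp_rw [hk]
    rw [integral_complex_ofReal, Complex.ofReal_re, ofReal_integral_eq_lintegral_ofReal]
    · refine (integrable_const (∫ v, ‖g v‖)).mono' (by fun_prop) (Eventually.of_forall fun y => ?_)
      rw [Real.norm_of_nonneg (hk0 _)]; exact hbd _
    · exact Eventually.of_forall fun y => hk0 _
  simp_rw [hden]
  have hm2 : Measurable (fun z : ℝ × ℝ => ENNReal.ofReal (k (z.1 - z.2))) := by fun_prop
  refine Measure.ext_of_lintegral _ fun f hf => ?_
  rw [Measure.lintegral_conv hf, lintegral_withDensity_eq_lintegral_mul _ hm2.lintegral_prod_right' hf]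
  have h1 : ∀ y, ∫⁻ x, f (y + x) ∂(volume.withDensity fun x => ENNReal.ofReal (k x)) =
      ∫⁻ x, ENNReal.ofReal (k (x - y)) * f x := by
    intro y
    rw [lintegral_withDensity_eq_lintegral_mul _ hkm (by fun_prop)]
    rw [← lintegral_add_left_eq_self (fun x => ENNReal.ofReal (k (x - y)) * f x) y]
    simp
  simp_rw [h1]
  rw [lintegral_lintegral_swap]
  · congr 1; ext x
    rw [Pi.mul_apply, lintegral_mul_const]
    fun_prop
  · apply Measurable.aemeasurable
    simp only [Function.uncurry_def]
    fun_prop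

lemma W_smooth1 {p : ℝ} (hp1 : 1 ≤ p) (hp2 : p ≤ 2) (g : ℝ → ℂ) (k : ℝ → ℝ)
    (hg : Integrable g) (hgc : Continuous g) (hk0 : ∀ x, 0 ≤ k x) (hkc : Continuous k)
    (hk : ∀ x, 𝓕 g x = (k x : ℂ)) (hki : Integrable k) (hk1 : ∫ x, k x = 1)
    (hk2 : Integrable (fun x => x ^ 2 * k x))
    (μ ν : Measure ℝ) [IsProbabilityMeasure μ] [IsProbabilityMeasure ν] :
    wasserstein p μ ν ≤ 2 * ENNReal.ofReal (Real.sqrt (∫ x, x ^ 2 * k x)) +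
      (2 ^ p * (2 * ∫⁻ x, ENNReal.ofReal |x| ^ p * ENNReal.ofReal
        ‖𝓕 (fun v => (charFun μ (2 * Real.pi * v) - charFun ν (2 * Real.pi * v)) * g v) x‖)) ^ (1 / p) := by
  set G : Measure ℝ := volume.withDensity fun x => ENNReal.ofReal (k x) with hG
  have hGp : IsProbabilityMeasure G := ⟨by
    rw [hG, withDensity_apply _ MeasurableSet.univ, Measure.restrict_univ,
      ← ofReal_integral_eq_lintegral_ofReal hki (Eventually.of_forall hk0), hk1, ENNReal.ofReal_one]⟩
  have hmom : (∫⁻ x, ENNReal.ofReal |x| ^ p ∂G) ^ (1 / p) ≤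
      ENNReal.ofReal (Real.sqrt (∫ x, x ^ 2 * k x)) := by
    refine (lp_le_l2 hp1 hp2 G measurable_id).trans ?_
    simp only [id]
    rw [hG, lintegral_withDensity_eq_lintegral_mul _ (by fun_prop) (by fun_prop)]
    have : ∫⁻ x, ((fun x => ENNReal.ofReal (k x)) * fun x => ENNReal.ofReal (x ^ 2)) x =
        ENNReal.ofReal (∫ x, x ^ 2 * k x) := by
      rw [ofReal_integral_eq_lintegral_ofReal hk2
        (Eventually.of_forall fun x => mul_nonneg (sq_nonneg x) (hk0 x))]
      congr 1; ext x
      rw [Pi.mul_apply, ← ENNReal.ofReal_mul (hk0 x), mul_comm]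
    rw [this, ENNReal.ofReal_rpow_of_nonneg _ (by norm_num), Real.sqrt_eq_rpow]
    exact integral_nonneg fun x => mul_nonneg (sq_nonneg x) (hk0 x)
  set fμ : ℝ → ℝ := fun x => (𝓕 (fun v => charFun μ (2 * Real.pi * v) * g v) x).re with hfμ
  set fν : ℝ → ℝ := fun x => (𝓕 (fun v => charFun ν (2 * Real.pi * v) * g v) x).re with hfν
  set D : ℝ → ℂ := 𝓕 (fun v => (charFun μ (2 * Real.pi * v) - charFun ν (2 * Real.pi * v)) * g v) with hD
  have eμ : μ ∗ G = volume.withDensity (fun x => ENNReal.ofReal (fμ x)) :=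
    smooth_density μ g k hg hgc hk0 hkc hk
  have eν : ν ∗ G = volume.withDensity (fun x => ENNReal.ofReal (fν x)) :=
    smooth_density ν g k hg hgc hk0 hkc hk
  have cF : ∀ f : ℝ → ℂ, Integrable f → Continuous (𝓕 f) := fun f hf =>
    VectorFourier.fourierIntegral_continuous Real.continuous_fourierChar (by exact continuous_inner) hf
  have iμ := integrable_cf_mul μ g hg
  have iν := integrable_cf_mul ν g hg
  have mμ : Measurable fμ := (Complex.continuous_re.comp (cF _ iμ)).measurable
  have mν : Measurable fν := (Complex.continuous_re.comp (cF _ iν)).measurable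
  have hsub : ∀ x, fμ x - fν x = (D x).re := by
    intro x
    simp only [hfμ, hfν, hD]
    rw [← Complex.sub_re]
    congr 1
    simp_rw [Real.fourier_eq]
    rw [← integral_sub ((Real.fourierIntegral_convergent_iff x).2 iμ)
      ((Real.fourierIntegral_convergent_iff x).2 iν)]
    congr 1; ext v
    rw [← smul_sub, sub_mul]
  have hpos : ∀ x, |fμ x - fν x| ≤ ‖D x‖ := fun x => by
    rw [hsub]; exact Complex.abs_re_le_norm _
  set mn : ℝ → ℝ≥0∞ := fun x => min (ENNReal.ofReal (fμ x)) (ENNReal.ofReal (fν x)) with hmn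
  have hmm : Measurable mn := by fun_prop
  set α := volume.withDensity mn
  set a := volume.withDensity (fun x => ENNReal.ofReal (fμ x) - mn x)
  set b := volume.withDensity (fun x => ENNReal.ofReal (fν x) - mn x)
  have ea : α + a = μ ∗ G := by
    rw [eμ, ← withDensity_add_left hmm]
    congr 1; ext x
    exact add_tsub_cancel_of_le (min_le_left (ENNReal.ofReal (fμ x)) (ENNReal.ofReal (fν x)))
  have eb : α + b = ν ∗ G := by
    rw [eν, ← withDensity_add_left hmm]
    congr 1; ext x
    exact add_tsub_cancel_of_le (min_le_right (ENNReal.ofReal (fμ x)) (ENNReal.ofReal (fν x)))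
  have aux : ∀ r s : ℝ, ENNReal.ofReal r - min (ENNReal.ofReal r) (ENNReal.ofReal s) ≤
      ENNReal.ofReal |r - s| := by
    intro r s
    rw [tsub_le_iff_right]
    rcases le_total (ENNReal.ofReal r) (ENNReal.ofReal s) with h | h
    · rw [min_eq_left h]; exact le_add_self
    · rw [min_eq_right h]
      calc ENNReal.ofReal r ≤ ENNReal.ofReal (|r - s| + s) :=
            ENNReal.ofReal_le_ofReal (by linarith [le_abs_self (r - s)])
        _ ≤ _ := ENNReal.ofReal_add_le
  have ma : ∫⁻ x, ENNReal.ofReal |x| ^ p ∂a ≤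
      ∫⁻ x, ENNReal.ofReal |x| ^ p * ENNReal.ofReal ‖D x‖ := by
    rw [lintegral_withDensity_eq_lintegral_mul _ (by fun_prop) (by fun_prop)]
    apply lintegral_mono
    intro x
    simp only [Pi.mul_apply]
    rw [mul_comm]
    gcongr
    exact (aux _ _).trans (ENNReal.ofReal_le_ofReal (hpos x))
  have mb : ∫⁻ x, ENNReal.ofReal |x| ^ p ∂b ≤
      ∫⁻ x, ENNReal.ofReal |x| ^ p * ENNReal.ofReal ‖D x‖ := by
    rw [lintegral_withDensity_eq_lintegral_mul _ (by fun_prop) (by fun_prop)]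
    apply lintegral_mono
    intro x
    simp only [Pi.mul_apply]
    rw [mul_comm]
    gcongr
    simp only [hmn]
    rw [min_comm]
    refine (aux _ _).trans (ENNReal.ofReal_le_ofReal ?_)
    rw [abs_sub_comm]; exact hpos x
  have : IsProbabilityMeasure (α + a) := ea ▸ inferInstance
  have : IsProbabilityMeasure (α + b) := eb ▸ inferInstance
  have htv := W_tv hp1 α a b
  rw [ea, eb] at htv
  have hmid : wasserstein p (μ ∗ G) (ν ∗ G) ≤ (2 ^ p * (2 * ∫⁻ x, ENNReal.ofReal |x| ^ p *
      ENNReal.ofReal ‖D x‖)) ^ (1 / p) := by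
    refine htv.trans ?_
    gcongr
    rw [two_mul]
    gcongr
  calc wasserstein p μ ν ≤ wasserstein p μ (μ ∗ G) + wasserstein p (μ ∗ G) ν := W_triangle hp1 _ _ _
    _ ≤ wasserstein p μ (μ ∗ G) + (wasserstein p (μ ∗ G) (ν ∗ G) + wasserstein p (ν ∗ G) ν) := by
        gcongr; exact W_triangle hp1 _ _ _
    _ ≤ ENNReal.ofReal (Real.sqrt (∫ x, x ^ 2 * k x)) + ((2 ^ p * (2 * ∫⁻ x, ENNReal.ofReal |x| ^ p *
      ENNReal.ofReal ‖D x‖)) ^ (1 / p) + ENNReal.ofReal (Real.sqrt (∫ x, x ^ 2 * k x))) := by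
        gcongr
        · exact (W_conv μ G).trans hmom
        · exact (W_symm p _ _).trans ((W_conv ν G).trans hmom)
    _ = _ := by ring

lemma W_smooth {p : ℝ} (hp1 : 1 ≤ p) (hp2 : p ≤ 2) (g : ℝ → ℂ) (k : ℝ → ℝ)
    (hg : Integrable g) (hgc : Continuous g) (hk0 : ∀ x, 0 ≤ k x) (hkc : Continuous k)
    (hk : ∀ x, 𝓕 g x = (k x : ℂ)) (hki : Integrable k) (hk1 : ∫ x, k x = 1)
    (hk2 : Integrable (fun x => x ^ 2 * k x))
    (μ ν : Measure ℝ) [IsProbabilityMeasure μ] [IsProbabilityMeasure ν] (l : ℝ) (hl : 0 < l) :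
    wasserstein p μ ν ≤ 2 * ENNReal.ofReal (l * Real.sqrt (∫ x, x ^ 2 * k x)) +
      (2 ^ p * (2 * ∫⁻ x, ENNReal.ofReal |x| ^ p * ENNReal.ofReal
        ‖𝓕 (fun v => (charFun μ (2 * Real.pi * v) - charFun ν (2 * Real.pi * v)) * g (l * v)) x‖)) ^ (1 / p) := by
  have hl' := hl.ne'
  have hx2 : ∀ x : ℝ, x ^ 2 * (l⁻¹ * k (l⁻¹ * x)) = l * ((l⁻¹ * x) ^ 2 * k (l⁻¹ * x)) := by
    intro x; field_simp
  have h := W_smooth1 hp1 hp2 (fun v => g (l * v)) (fun x => l⁻¹ * k (l⁻¹ * x))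
    (hg.comp_mul_left' hl') (by fun_prop) (fun x => mul_nonneg (by positivity) (hk0 _)) (by fun_prop)
    (fun x => ?_) ((hki.comp_mul_left' (inv_ne_zero hl')).const_mul _) ?_ ?_ μ ν
  · convert h using 4
    simp_rw [hx2]
    rw [integral_const_mul, Measure.integral_comp_mul_left (fun x => x ^ 2 * k x) l⁻¹]
    rw [inv_inv, abs_of_pos hl, smul_eq_mul, ← mul_assoc, Real.sqrt_mul' _ (integral_nonneg fun x => mul_nonneg (sq_nonneg x) (hk0 x)),
      Real.sqrt_mul_self hl.le]
  · push_cast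
    rw [← hk, Real.fourier_real_eq, Real.fourier_real_eq]
    have := Measure.integral_comp_mul_left (fun v => 𝐞 (-(v * (l⁻¹ * x))) • g v) l
    rw [abs_of_pos (inv_pos.2 hl)] at this
    rw [← Complex.ofReal_inv, ← Complex.real_smul, ← this]
    congr 1; ext v
    congr 3
    field_simp
  · rw [integral_const_mul, Measure.integral_comp_mul_left k l⁻¹, hk1, inv_inv, abs_of_pos hl]
    simp [hl']
  · simp_rw [hx2]
    exact (hk2.comp_mul_left' (inv_ne_zero hl')).const_mul l

end Part4


section Part5
open Filter Topology
open scoped FourierTransform ContDiff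

structure Adm (p K δ c : ℝ) (ψ ψ1 ψ2 ψ3 : ℝ → ℂ) : Prop where
  h1 : ∀ u, HasDerivAt ψ (ψ1 u) u
  h2 : ∀ u, HasDerivAt ψ1 (ψ2 u) u
  h3 : ∀ u, HasDerivAt ψ2 (ψ3 u) u
  smooth : ContDiff ℝ ∞ ψ
  z0 : ψ 0 = 0
  z1 : ψ1 0 = 0
  z2 : ψ2 0 = -1
  b3 : ∀ u : ℝ, ‖ψ3 u + c * Complex.I‖ ≤ K * δ ^ p * |u| ^ (p - 1)

lemma Adm.b2 {p K δ c : ℝ} {ψ ψ1 ψ2 ψ3 : ℝ → ℂ} (h : Adm p K δ c ψ ψ1 ψ2 ψ3) (hp : 1 ≤ p)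
    (hK : 0 ≤ K) (hδ : 0 ≤ δ) (u : ℝ) :
    ‖ψ2 u + 1 + c * Complex.I * u‖ ≤ K * δ ^ p * |u| ^ p := by
  have := mv_bound (F := fun u : ℝ => ψ2 u + 1 + c * Complex.I * u)
    (F' := fun u => ψ3 u + c * Complex.I) (fun v => ?_) (by simp [h.z2])
    (A := K * δ ^ p) (q := p - 1) (by positivity) (by linarith) h.b3 u
  · simpa using this
  · have h1 : HasDerivAt (fun u : ℝ => c * Complex.I * (u : ℂ)) (c * Complex.I) v := by
      simpa using (hasDerivAt_id v).ofReal_comp.const_mul (c * Complex.I)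
    exact ((h.h3 v).add_const 1).add h1

lemma Adm.b1 {p K δ c : ℝ} {ψ ψ1 ψ2 ψ3 : ℝ → ℂ} (h : Adm p K δ c ψ ψ1 ψ2 ψ3) (hp : 1 ≤ p)
    (hK : 0 ≤ K) (hδ : 0 ≤ δ) (u : ℝ) :
    ‖ψ1 u + u + c * Complex.I * u ^ 2 / 2‖ ≤ K * δ ^ p * |u| ^ (p + 1) := by
  refine mv_bound (F := fun u : ℝ => ψ1 u + u + c * Complex.I * u ^ 2 / 2)
    (F' := fun u => ψ2 u + 1 + c * Complex.I * u) (fun v => ?_) (by simp [h.z1])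
    (A := K * δ ^ p) (q := p) (by positivity) (by linarith) (h.b2 hp hK hδ) u
  have h0 : HasDerivAt (fun u : ℝ => (u : ℂ)) 1 v := by
    simpa using (hasDerivAt_id v).ofReal_comp
  convert! ((h.h2 v).add h0).add (((h0.pow 2).const_mul (c * Complex.I)).div_const 2) using 1
  push_cast; ring

lemma Adm.b0 {p K δ c : ℝ} {ψ ψ1 ψ2 ψ3 : ℝ → ℂ} (h : Adm p K δ c ψ ψ1 ψ2 ψ3) (hp : 1 ≤ p)
    (hK : 0 ≤ K) (hδ : 0 ≤ δ) (u : ℝ) :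
    ‖ψ u + u ^ 2 / 2 + c * Complex.I * u ^ 3 / 6‖ ≤ K * δ ^ p * |u| ^ (p + 2) := by
  have := mv_bound (F := fun u : ℝ => ψ u + u ^ 2 / 2 + c * Complex.I * u ^ 3 / 6)
    (F' := fun u => ψ1 u + u + c * Complex.I * u ^ 2 / 2) (fun v => ?_) (by simp [h.z0])
    (A := K * δ ^ p) (q := p + 1) (by positivity) (by linarith) (h.b1 hp hK hδ) u
  · rwa [show p + 1 + 1 = p + 2 by ring] at this
  have h0 : HasDerivAt (fun u : ℝ => (u : ℂ)) 1 v := by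
    simpa using (hasDerivAt_id v).ofReal_comp
  convert! ((h.h1 v).add ((h0.pow 2).div_const 2)).add (((h0.pow 3).const_mul (c * Complex.I)).div_const 6) using 1
  push_cast; ring

lemma small_rpow {p δ u K : ℝ} (hp : 1 ≤ p) (hK : 1 ≤ K) (hδ : 0 < δ) (hu : 32 * K * δ * |u| ≤ 1) :
    K * δ ^ p * |u| ^ p ≤ 1 / 32 := by
  rw [mul_assoc, ← Real.mul_rpow hδ.le (abs_nonneg u)]
  have h1 : 0 ≤ δ * |u| := by positivity
  have h2 : δ * |u| ≤ 1 := by nlinarith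
  have h3 : (δ * |u|) ^ p ≤ δ * |u| := by
    have := Real.rpow_le_rpow_of_exponent_ge_of_imp h1 h2 hp (by intro _ h; linarith)
    simpa using this
  nlinarith

lemma Adm.re_le {p K δ c : ℝ} {ψ ψ1 ψ2 ψ3 : ℝ → ℂ} (h : Adm p K δ c ψ ψ1 ψ2 ψ3) (hp : 1 ≤ p)
    (hK : 1 ≤ K) (hδ : 0 < δ) {u : ℝ} (hu : 32 * K * δ * |u| ≤ 1) :
    (ψ u).re ≤ - (15 / 32) * u ^ 2 := by
  have hb := h.b0 hp (by linarith) hδ.le u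
  have e : |u| ^ (p + 2) = |u| ^ p * u ^ 2 := by
    rw [Real.rpow_add' (abs_nonneg u) (by linarith)]; norm_num
  rw [e] at hb
  have hs := small_rpow hp hK hδ hu
  have h2 := (Complex.abs_re_le_norm _).trans hb
  have hre : (ψ u + (u : ℂ) ^ 2 / 2 + c * Complex.I * u ^ 3 / 6).re = (ψ u).re + u ^ 2 / 2 := by
    have e1 : ((u : ℂ) ^ 2 / 2).re = u ^ 2 / 2 := by
      rw [show (u : ℂ) ^ 2 / 2 = ((u ^ 2 / 2 : ℝ) : ℂ) by push_cast; ring, Complex.ofReal_re]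
    have e2 : ((c : ℂ) * Complex.I * u ^ 3 / 6).re = 0 := by
      rw [show (c : ℂ) * Complex.I * u ^ 3 / 6 = ((c * u ^ 3 / 6 : ℝ) : ℂ) * Complex.I by push_cast; ring]
      rw [Complex.re_ofReal_mul, Complex.I_re, mul_zero]
    rw [Complex.add_re, Complex.add_re, e1, e2, add_zero]
  rw [hre] at h2
  have h3 := (abs_le.1 h2).2
  nlinarith [sq_nonneg u]

lemma Adm.size {p K δ c : ℝ} {ψ ψ1 ψ2 ψ3 : ℝ → ℂ} (h : Adm p K δ c ψ ψ1 ψ2 ψ3) (hp : 1 ≤ p)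
    (hp2 : p ≤ 2) (hK : 1 ≤ K) (hδ : 0 < δ) (hδ1 : δ ≤ 1) (hc : |c| ≤ δ) {u : ℝ}
    (hu : 32 * K * δ * |u| ≤ 1) :
    ‖ψ1 u‖ ≤ (K + 3) * (1 + |u|) ∧ ‖ψ2 u‖ ≤ (K + 3) * (1 + |u|) ∧ ‖ψ3 u‖ ≤ (K + 3) * (1 + |u|) := by
  have hs := small_rpow hp hK hδ hu
  have ha := abs_nonneg u
  have hδu : δ * |u| ≤ 1 := by nlinarith [mul_nonneg hδ.le ha]
  have hcu : |c| * |u| ≤ 1 := le_trans (by gcongr) hδu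
  have n0 : ‖(u : ℂ)‖ = |u| := Complex.norm_real u
  have nc : ‖(c : ℂ) * Complex.I‖ = |c| := by simp
  refine ⟨?_, ?_, ?_⟩
  · have hb := h.b1 hp (by linarith) hδ.le u
    rw [Real.rpow_add' ha (by linarith), Real.rpow_one] at hb
    have e : ψ1 u = (ψ1 u + u + c * Complex.I * u ^ 2 / 2) - u - c * Complex.I * u ^ 2 / 2 := by ring
    have n2 : ‖(c : ℂ) * Complex.I * u ^ 2 / 2‖ = |c| * |u| * |u| / 2 := by
      rw [norm_div, norm_mul, nc, norm_pow, n0, Complex.norm_ofNat]; ring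
    rw [e]
    refine (norm_sub_le _ _).trans ?_
    refine (add_le_add_left (norm_sub_le _ _) _).trans ?_
    rw [n0, n2]
    nlinarith
  · have hb := h.b2 hp (by linarith) hδ.le u
    have e : ψ2 u = (ψ2 u + 1 + c * Complex.I * u) - 1 - c * Complex.I * u := by ring
    have n2 : ‖(c : ℂ) * Complex.I * u‖ = |c| * |u| := by rw [norm_mul, nc, n0]
    rw [e]
    refine (norm_sub_le _ _).trans ?_
    refine (add_le_add_left (norm_sub_le _ _) _).trans ?_
    rw [n2, norm_one]
    nlinarith
  · have hb := h.b3 u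
    have e : ψ3 u = (ψ3 u + c * Complex.I) - c * Complex.I := by ring
    rw [e]
    refine (norm_sub_le _ _).trans ?_
    rw [nc]
    have h1 : |u| ^ (p - 1) ≤ 1 + |u| := by
      rcases le_total |u| 1 with h | h
      · have := Real.rpow_le_one ha h (z := p - 1) (by linarith); linarith
      · have := Real.rpow_le_rpow_of_exponent_le h (y := p - 1) (z := 1) (by linarith)
        rw [Real.rpow_one] at this; linarith
    have h2 : δ ^ p ≤ 1 := Real.rpow_le_one hδ.le hδ1 (by linarith)
    have h3 : K * δ ^ p * |u| ^ (p - 1) ≤ K * 1 * (1 + |u|) := by gcongr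
    nlinarith

lemma rpow_le_pow4 {u r : ℝ} (hr : 0 ≤ r) (hr4 : r ≤ 4) : |u| ^ r ≤ (1 + |u|) ^ 4 := by
  calc |u| ^ r ≤ (1 + |u|) ^ r := by gcongr; linarith
    _ ≤ (1 + |u|) ^ (4 : ℝ) := Real.rpow_le_rpow_of_exponent_le (by linarith [abs_nonneg u]) hr4
    _ = _ := by norm_cast

set_option maxHeartbeats 1000000 in
lemma E_bounds {p K δ c : ℝ} {X X1 X2 X3 Y Y1 Y2 Y3 : ℝ → ℂ} (hX : Adm p K δ c X X1 X2 X3)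
    (hY : Adm p K δ c Y Y1 Y2 Y3) (hp : 1 ≤ p)
    (hp2 : p ≤ 2) (hK : 1 ≤ K) (hδ : 0 < δ) (hδ1 : δ ≤ 1) (hc : |c| ≤ δ) {u : ℝ}
    (hu : 32 * K * δ * |u| ≤ 1) :
    let Q := 15 * (K + 3) ^ 3 * (2 * K * δ ^ p) * (1 + |u|) ^ 7 * Real.exp (-u ^ 2 / 4)
    ‖Complex.exp (X u) - Complex.exp (Y u)‖ ≤ Q ∧
    ‖X1 u * Complex.exp (X u) - Y1 u * Complex.exp (Y u)‖ ≤ Q ∧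
    ‖(X2 u + X1 u ^ 2) * Complex.exp (X u) - (Y2 u + Y1 u ^ 2) * Complex.exp (Y u)‖ ≤ Q ∧
    ‖(X3 u + 3 * X1 u * X2 u + X1 u ^ 3) * Complex.exp (X u) -
      (Y3 u + 3 * Y1 u * Y2 u + Y1 u ^ 3) * Complex.exp (Y u)‖ ≤ Q := by
  intro Q
  have hK0 : 0 ≤ K := by linarith
  set D := 2 * K * δ ^ p with hD
  have hD0 : 0 ≤ D := by positivity
  set a := 1 + |u| with ha
  have ha1 : 1 ≤ a := by linarith [abs_nonneg u]
  set M := K + 3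
  have hM : 1 ≤ M := by simp only [M]; linarith
  set w := Real.exp (-u ^ 2 / 4) with hw
  have hw0 : 0 < w := Real.exp_pos _
  obtain ⟨sx1, sx2, sx3⟩ := hX.size hp hp2 hK hδ hδ1 hc hu
  obtain ⟨sy1, sy2, sy3⟩ := hY.size hp hp2 hK hδ hδ1 hc hu
  have gen : ∀ (x y z : ℂ) (r : ℝ), 0 ≤ r → r ≤ 4 → ‖x + z‖ ≤ K * δ ^ p * |u| ^ r →
      ‖y + z‖ ≤ K * δ ^ p * |u| ^ r → ‖x - y‖ ≤ D * a ^ 4 := by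
    intro x y z r hr hr4 h1 h2
    have h3 := rpow_le_pow4 (u := u) hr hr4
    have h4 : K * δ ^ p * |u| ^ r ≤ K * δ ^ p * a ^ 4 := by gcongr
    calc ‖x - y‖ = ‖(x + z) - (y + z)‖ := by congr 1; ring
      _ ≤ ‖x + z‖ + ‖y + z‖ := norm_sub_le _ _
      _ ≤ D * a ^ 4 := by rw [hD]; linarith
  have d0 : ‖X u - Y u‖ ≤ D * a ^ 4 := gen _ _ (u ^ 2 / 2 + c * Complex.I * u ^ 3 / 6) (p + 2)
    (by linarith) (by linarith) (by simpa [add_assoc] using hX.b0 hp hK0 hδ.le u)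
      (by simpa [add_assoc] using hY.b0 hp hK0 hδ.le u)
  have d1 : ‖X1 u - Y1 u‖ ≤ D * a ^ 4 := gen _ _ (u + c * Complex.I * u ^ 2 / 2) (p + 1)
    (by linarith) (by linarith) (by simpa [add_assoc] using hX.b1 hp hK0 hδ.le u)
      (by simpa [add_assoc] using hY.b1 hp hK0 hδ.le u)
  have d2 : ‖X2 u - Y2 u‖ ≤ D * a ^ 4 := gen _ _ (1 + c * Complex.I * u) p
    (by linarith) (by linarith) (by simpa [add_assoc] using hX.b2 hp hK0 hδ.le u)
      (by simpa [add_assoc] using hY.b2 hp hK0 hδ.le u)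
  have d3 : ‖X3 u - Y3 u‖ ≤ D * a ^ 4 := gen _ _ (c * Complex.I) (p - 1)
    (by linarith) (by linarith) (hX.b3 u) (hY.b3 u)
  have hd0' : ‖X u - Y u‖ ≤ u ^ 2 / 16 := by
    have e : |u| ^ (p + 2) = |u| ^ p * u ^ 2 := by
      rw [Real.rpow_add' (abs_nonneg u) (by linarith)]; norm_num
    have h1 := hX.b0 hp hK0 hδ.le u
    have h2 := hY.b0 hp hK0 hδ.le u
    have hs := small_rpow hp hK hδ hu
    rw [e] at h1 h2
    have h3 : K * δ ^ p * (|u| ^ p * u ^ 2) ≤ 1 / 32 * u ^ 2 := by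
      rw [← mul_assoc]; gcongr
    calc ‖X u - Y u‖ = ‖(X u + u ^ 2 / 2 + c * Complex.I * u ^ 3 / 6) -
          (Y u + u ^ 2 / 2 + c * Complex.I * u ^ 3 / 6)‖ := by congr 1; ring
      _ ≤ _ := norm_sub_le _ _
      _ ≤ u ^ 2 / 16 := by linarith
  have hrx := hX.re_le hp hK hδ hu
  have hry := hY.re_le hp hK hδ hu
  have nX : ‖Complex.exp (X u)‖ ≤ w := by
    rw [Complex.norm_exp, hw]; apply Real.exp_le_exp.2; nlinarith [sq_nonneg u]
  have nE : ‖Complex.exp (X u) - Complex.exp (Y u)‖ ≤ D * a ^ 4 * w := by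
    have e : Complex.exp (X u) - Complex.exp (Y u) =
        Complex.exp (Y u) * (Complex.exp (X u - Y u) - 1) := by
      rw [mul_sub, ← Complex.exp_add]; ring_nf
    have h1 := Complex.norm_exp_sub_sum_le_norm_mul_exp (X u - Y u) 1
    simp only [Finset.range_one, Finset.sum_singleton, pow_zero, Nat.factorial_zero, Nat.cast_one,
      div_one, pow_one] at h1
    rw [e, norm_mul, Complex.norm_exp]
    calc Real.exp (Y u).re * ‖Complex.exp (X u - Y u) - 1‖
        ≤ Real.exp (- (15 / 32) * u ^ 2) * (D * a ^ 4 * Real.exp (u ^ 2 / 16)) := by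
          gcongr
          refine h1.trans ?_
          gcongr
      _ = D * a ^ 4 * Real.exp (- (15 / 32) * u ^ 2 + u ^ 2 / 16) := by rw [Real.exp_add]; ring
      _ ≤ _ := by
          rw [hw]; gcongr
          nlinarith [sq_nonneg u]
  have split : ∀ A B : ℂ, ‖A * Complex.exp (X u) - B * Complex.exp (Y u)‖ ≤
      ‖A - B‖ * w + ‖B‖ * (D * a ^ 4 * w) := by
    intro A B
    rw [show A * Complex.exp (X u) - B * Complex.exp (Y u) =
      (A - B) * Complex.exp (X u) + B * (Complex.exp (X u) - Complex.exp (Y u)) by ring]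
    refine (norm_add_le _ _).trans ?_
    rw [norm_mul, norm_mul]
    gcongr
  have hMa : 1 ≤ M * a := by nlinarith
  have hQ : Q = (15 * (M * a) ^ 3) * (D * a ^ 4 * w) := by simp only [Q]; ring
  have hT : 0 ≤ D * a ^ 4 * w := by positivity
  set T := M * a with hTdef
  have T2 : T ≤ T ^ 2 := le_self_pow₀ hMa (by norm_num)
  have T3 : T ^ 2 ≤ T ^ 3 := pow_le_pow_right₀ hMa (by norm_num)
  have T1 : 1 ≤ T ^ 3 := one_le_pow₀ hMa
  have fin : ∀ (A B : ℂ) (r s : ℝ), ‖A - B‖ ≤ r * (D * a ^ 4) → ‖B‖ ≤ s → r + s ≤ 15 * T ^ 3 →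
      ‖A * Complex.exp (X u) - B * Complex.exp (Y u)‖ ≤ Q := by
    intro A B r s h1 h2 h3
    refine (split A B).trans ?_
    rw [hQ]
    calc _ ≤ r * (D * a ^ 4) * w + s * (D * a ^ 4 * w) := by gcongr
      _ = (r + s) * (D * a ^ 4 * w) := by ring
      _ ≤ _ := by gcongr
  have hT0 : 0 ≤ T := by linarith
  have hDa : 0 ≤ D * a ^ 4 := by positivity
  refine ⟨?_, ?_, ?_, ?_⟩
  · rw [hQ]; refine nE.trans (le_mul_of_one_le_left hT (by linarith only [T1]))
  · exact fin _ _ 1 T (by simpa using d1) sy1 (by linarith only [T1, T2, T3])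
  · refine fin _ _ (1 + 2 * T) (T + T ^ 2) ?_ ?_ (by linarith only [T1, T2, T3])
    · rw [show X2 u + X1 u ^ 2 - (Y2 u + Y1 u ^ 2) =
        (X2 u - Y2 u) + (X1 u - Y1 u) * (X1 u + Y1 u) by ring]
      refine (norm_add_le _ _).trans ?_
      rw [norm_mul]
      have : ‖X1 u + Y1 u‖ ≤ 2 * T := (norm_add_le _ _).trans (by linarith)
      have : ‖X1 u - Y1 u‖ * ‖X1 u + Y1 u‖ ≤ D * a ^ 4 * (2 * T) := by gcongr
      linarith only [this, d2]
    · refine (norm_add_le _ _).trans ?_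
      rw [norm_pow]
      gcongr
  · refine fin _ _ (1 + 6 * T + 3 * T ^ 2) (T + 3 * T ^ 2 + T ^ 3) ?_ ?_ (by linarith only [T1, T2, T3])
    · rw [show X3 u + 3 * X1 u * X2 u + X1 u ^ 3 - (Y3 u + 3 * Y1 u * Y2 u + Y1 u ^ 3) =
        (X3 u - Y3 u) + 3 * ((X1 u - Y1 u) * X2 u + (X2 u - Y2 u) * Y1 u) +
          (X1 u - Y1 u) * (X1 u ^ 2 + X1 u * Y1 u + Y1 u ^ 2) by ring]
      refine (norm_add_le _ _).trans ?_
      have k1 : ‖(X1 u - Y1 u) * X2 u + (X2 u - Y2 u) * Y1 u‖ ≤ D * a ^ 4 * T + D * a ^ 4 * T := by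
        refine (norm_add_le _ _).trans ?_
        rw [norm_mul, norm_mul]; gcongr
      have k2 : ‖X1 u ^ 2 + X1 u * Y1 u + Y1 u ^ 2‖ ≤ T ^ 2 + T * T + T ^ 2 := by
        refine (norm_add₃_le).trans ?_
        rw [norm_mul, norm_pow, norm_pow]; gcongr
      have k3 : ‖(X1 u - Y1 u) * (X1 u ^ 2 + X1 u * Y1 u + Y1 u ^ 2)‖ ≤
          D * a ^ 4 * (T ^ 2 + T * T + T ^ 2) := by rw [norm_mul]; gcongr
      have k4 : ‖(X3 u - Y3 u) + 3 * ((X1 u - Y1 u) * X2 u + (X2 u - Y2 u) * Y1 u)‖ ≤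
          D * a ^ 4 + 3 * (D * a ^ 4 * T + D * a ^ 4 * T) := by
        refine (norm_add_le _ _).trans ?_
        rw [norm_mul]
        have : ‖(3 : ℂ)‖ = 3 := by norm_num
        rw [this]; gcongr
      linarith only [k3, k4]
    · refine (norm_add₃_le).trans ?_
      rw [norm_mul, norm_mul, norm_pow]
      have : ‖(3 : ℂ)‖ = 3 := by norm_num
      rw [this]
      have k1 : 3 * ‖Y1 u‖ * ‖Y2 u‖ ≤ 3 * T * T := by gcongr
      have k2 : ‖Y1 u‖ ^ 3 ≤ T ^ 3 := by gcongr
      linarith only [k1, k2, sy3, show T * T = T ^ 2 by ring, show 3 * T * T = 3 * T ^ 2 by ring]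

end Part5


section Part6
open Filter Topology
open scoped FourierTransform ContDiff

lemma integrable_W : Integrable (fun u : ℝ => ((1 + |u|) ^ 7 * Real.exp (-u ^ 2 / 4)) ^ 2) := by
  have i1 : Integrable fun u : ℝ => u ^ (14 : ℝ) * Real.exp (-(1 / 2) * u ^ 2) :=
    integrable_rpow_mul_exp_neg_mul_sq (by norm_num) (by norm_num)
  have i2 : Integrable fun u : ℝ => Real.exp (-(1 / 2) * u ^ 2) :=
    integrable_exp_neg_mul_sq (by norm_num)
  refine ((i2.add i1).const_mul (2 ^ 13)).mono' (by fun_prop) (Eventually.of_forall fun u => ?_)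
  have h := add_pow_le (zero_le_one) (abs_nonneg u) 14
  have e : |u| ^ 14 = u ^ 14 := (show Even 14 by decide).pow_abs u
  rw [e, one_pow] at h
  have e2 : u ^ (14 : ℝ) = u ^ 14 := by norm_cast
  rw [Real.norm_of_nonneg (by positivity), mul_pow, ← pow_mul, ← Real.exp_nat_mul]
  simp only [Pi.add_apply, e2]
  rw [show ((2 : ℕ) : ℝ) * (-u ^ 2 / 4) = -(1 / 2) * u ^ 2 by push_cast; ring]
  norm_num at h
  have := Real.exp_pos (-(1 / 2) * u ^ 2)
  norm_num only
  calc _ ≤ (8192 * (1 + u ^ 14)) * Real.exp (-(1 / 2) * u ^ 2) := by gcongr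
    _ = _ := by ring

lemma g_data (g : ℝ → ℂ) (hg : ContDiff ℝ ∞ g) (hs : HasCompactSupport g) :
    ∃ g1 g2 g3 : ℝ → ℂ, (∀ u, HasDerivAt g (g1 u) u) ∧ (∀ u, HasDerivAt g1 (g2 u) u) ∧
      (∀ u, HasDerivAt g2 (g3 u) u) ∧ ∃ N R : ℝ, 1 ≤ N ∧ 1 ≤ R ∧
      ∀ u, (‖g u‖ ≤ N ∧ ‖g1 u‖ ≤ N ∧ ‖g2 u‖ ≤ N ∧ ‖g3 u‖ ≤ N) ∧
        (R < |u| → g u = 0 ∧ g1 u = 0 ∧ g2 u = 0 ∧ g3 u = 0) := by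
  have c1 := ((contDiff_infty_iff_deriv (𝕜 := ℝ)).1 hg).2
  have c2 := ((contDiff_infty_iff_deriv (𝕜 := ℝ)).1 c1).2
  have c3 := ((contDiff_infty_iff_deriv (𝕜 := ℝ)).1 c2).2
  have s1 := hs.deriv
  have s2 := s1.deriv
  have s3 := s2.deriv
  obtain ⟨N0, h0⟩ := hg.continuous.bounded_above_of_compact_support hs
  obtain ⟨N1, h1⟩ := c1.continuous.bounded_above_of_compact_support s1
  obtain ⟨N2, h2⟩ := c2.continuous.bounded_above_of_compact_support s2
  obtain ⟨N3, h3⟩ := c3.continuous.bounded_above_of_compact_support s3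
  have z : ∀ f : ℝ → ℂ, HasCompactSupport f → ∃ R, ∀ u, R < |u| → f u = 0 := by
    intro f hf
    obtain ⟨R, hR⟩ := hf.isCompact.isBounded.subset_closedBall 0
    refine ⟨R, fun u hu => ?_⟩
    by_contra hne
    have := hR (subset_tsupport f hne)
    rw [mem_closedBall_zero_iff, Real.norm_eq_abs] at this
    linarith
  obtain ⟨R0, r0⟩ := z _ hs
  obtain ⟨R1, r1⟩ := z _ s1
  obtain ⟨R2, r2⟩ := z _ s2
  obtain ⟨R3, r3⟩ := z _ s3
  have a0 := le_abs_self N0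
  have a1 := le_abs_self N1
  have a2 := le_abs_self N2
  have a3 := le_abs_self N3
  have b0 := le_abs_self R0
  have b1 := le_abs_self R1
  have b2 := le_abs_self R2
  have b3 := le_abs_self R3
  have d : ∀ f : ℝ → ℂ, ContDiff ℝ ∞ f → ∀ u, HasDerivAt f (deriv f u) u := fun f hf u =>
    (hf.differentiable (by simp) u).hasDerivAt
  refine ⟨_, _, _, d _ hg, d _ c1, d _ c2, 1 + |N0| + |N1| + |N2| + |N3|,
    1 + |R0| + |R1| + |R2| + |R3|, ?_, ?_, fun u => ⟨⟨?_, ?_, ?_, ?_⟩, fun hu => ⟨?_, ?_, ?_, ?_⟩⟩⟩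
  any_goals linarith [abs_nonneg N0, abs_nonneg N1, abs_nonneg N2, abs_nonneg N3,
    abs_nonneg R0, abs_nonneg R1, abs_nonneg R2, abs_nonneg R3]
  · exact (h0 u).trans (by linarith [abs_nonneg N0, abs_nonneg N1, abs_nonneg N2, abs_nonneg N3])
  · exact (h1 u).trans (by linarith [abs_nonneg N0, abs_nonneg N1, abs_nonneg N2, abs_nonneg N3])
  · exact (h2 u).trans (by linarith [abs_nonneg N0, abs_nonneg N1, abs_nonneg N2, abs_nonneg N3])
  · exact (h3 u).trans (by linarith [abs_nonneg N0, abs_nonneg N1, abs_nonneg N2, abs_nonneg N3])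
  · exact r0 u (by linarith [abs_nonneg R0, abs_nonneg R1, abs_nonneg R2, abs_nonneg R3])
  · exact r1 u (by linarith [abs_nonneg R0, abs_nonneg R1, abs_nonneg R2, abs_nonneg R3])
  · exact r2 u (by linarith [abs_nonneg R0, abs_nonneg R1, abs_nonneg R2, abs_nonneg R3])
  · exact r3 u (by linarith [abs_nonneg R0, abs_nonneg R1, abs_nonneg R2, abs_nonneg R3])

lemma exp_derivs {X X1 X2 X3 : ℝ → ℂ} (h1 : ∀ u, HasDerivAt X (X1 u) u)
    (h2 : ∀ u, HasDerivAt X1 (X2 u) u) (h3 : ∀ u, HasDerivAt X2 (X3 u) u) (u : ℝ) :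
    HasDerivAt (fun u => Complex.exp (X u)) (X1 u * Complex.exp (X u)) u ∧
    HasDerivAt (fun u => X1 u * Complex.exp (X u)) ((X2 u + X1 u ^ 2) * Complex.exp (X u)) u ∧
    HasDerivAt (fun u => (X2 u + X1 u ^ 2) * Complex.exp (X u))
      ((X3 u + 3 * X1 u * X2 u + X1 u ^ 3) * Complex.exp (X u)) u := by
  have e1 := (h1 u).cexp
  refine ⟨?_, ?_, ?_⟩
  · convert! e1 using 1; ring
  · convert! (h2 u).mul e1 using 1; ring
  · convert! ((h3 u).add ((h2 u).pow 2)).mul e1 using 1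
    simp only [Pi.add_apply, Pi.pow_apply]; push_cast; ring

theorem core (p K : ℝ) (hp1 : 1 ≤ p) (hp2 : p ≤ 2) (hK : 1 ≤ K) : ∃ C > (0 : ℝ), ∀ δ c : ℝ,
    0 < δ → δ ≤ 1 → |c| ≤ δ → ∀ X X1 X2 X3 Y Y1 Y2 Y3 : ℝ → ℂ, Adm p K δ c X X1 X2 X3 →
    Adm p K δ c Y Y1 Y2 Y3 → ∀ (μ ν : Measure ℝ) [IsProbabilityMeasure μ] [IsProbabilityMeasure ν],
    (∀ v, charFun μ (2 * Real.pi * v) = Complex.exp (X v)) →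
    (∀ v, charFun ν (2 * Real.pi * v) = Complex.exp (Y v)) →
    wasserstein p μ ν ≤ ENNReal.ofReal (C * δ) := by
  obtain ⟨g, k, hg, hgs, -, hk0, hkc, hk, hki, hk1, hk2⟩ := ex_kernel
  obtain ⟨g1, g2, g3, d1, d2, d3, N, R, hN, hR, hb⟩ := g_data g hg hgs
  set I0 := ∫ u : ℝ, ((1 + |u|) ^ 7 * Real.exp (-u ^ 2 / 4)) ^ 2 with hI0
  have hI00 : 0 ≤ I0 := integral_nonneg fun u => by positivity
  set L := 32 * K * R with hL
  have hL1 : 1 ≤ L := by nlinarith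
  set A := 8 * N * L ^ 3 * (15 * (K + 3) ^ 3 * (2 * K)) with hA
  have hA0 : 0 < A := by positivity
  set m := Real.sqrt (∫ x, x ^ 2 * k x)
  set A' := A * Real.sqrt (I0 + 1) with hA'
  have hA'0 : 0 < A' := by positivity
  refine ⟨2 * (L * m) + (2 ^ p * (2 * (5 * A'))) ^ (1 / p), by positivity, ?_⟩
  intro δ c hδ hδ1 hc X X1 X2 X3 Y Y1 Y2 Y3 hX hY μ ν _ _ hμ hν
  set l := L * δ with hl
  have hl0 : 0 < l := by positivity
  have hlL : l ≤ L := by nlinarith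
  set F0 : ℝ → ℂ := fun v => Complex.exp (X v) - Complex.exp (Y v) with hF0
  set F1 : ℝ → ℂ := fun u => X1 u * Complex.exp (X u) - Y1 u * Complex.exp (Y u) with hF1
  set F2 : ℝ → ℂ := fun u =>
    (X2 u + X1 u ^ 2) * Complex.exp (X u) - (Y2 u + Y1 u ^ 2) * Complex.exp (Y u) with hF2
  set F3 : ℝ → ℂ := fun u => (X3 u + 3 * X1 u * X2 u + X1 u ^ 3) * Complex.exp (X u) -
      (Y3 u + 3 * Y1 u * Y2 u + Y1 u ^ 3) * Complex.exp (Y u) with hF3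
  have D1 : ∀ u, HasDerivAt F0 (F1 u) u := fun u =>
    (exp_derivs hX.h1 hX.h2 hX.h3 u).1.sub (exp_derivs hY.h1 hY.h2 hY.h3 u).1
  have D2 : ∀ u, HasDerivAt F1 (F2 u) u := fun u =>
    (exp_derivs hX.h1 hX.h2 hX.h3 u).2.1.sub (exp_derivs hY.h1 hY.h2 hY.h3 u).2.1
  have D3 : ∀ u, HasDerivAt F2 (F3 u) u := fun u =>
    (exp_derivs hX.h1 hX.h2 hX.h3 u).2.2.sub (exp_derivs hY.h1 hY.h2 hY.h3 u).2.2
  have hlin : ∀ u : ℝ, HasDerivAt (fun v : ℝ => l * v) l u := fun u => by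
    simpa using (hasDerivAt_id u).const_mul l
  have sc : ∀ f f1 : ℝ → ℂ, (∀ u, HasDerivAt f (f1 u) u) → ∀ u,
      HasDerivAt (fun v => f (l * v)) (l * f1 (l * u)) u := by
    intro f f1 h u
    have := (h (l * u)).scomp u (hlin u)
    simpa [Function.comp_def] using this
  have G1 := sc _ _ d1
  have G2 := sc _ _ d2
  have G3 := sc _ _ d3
  have Q : ∀ v, |l * v| ≤ R → 32 * K * δ * |v| ≤ 1 := by
    intro v hv
    rw [abs_mul, abs_of_pos hl0, hl, hL] at hv
    have : R * (32 * K * δ * |v|) ≤ R * 1 := by linarith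
    exact le_of_mul_le_mul_left this (by linarith)
  have bound : ∀ v, ‖F0 v * g (l * v)‖ ≤ A * δ ^ p * ((1 + |v|) ^ 7 * Real.exp (-v ^ 2 / 4)) ∧
      ‖F3 v * g (l * v) + 3 * F2 v * (l * g1 (l * v)) + 3 * F1 v * (l ^ 2 * g2 (l * v)) +
        F0 v * (l ^ 3 * g3 (l * v))‖ ≤ A * δ ^ p * ((1 + |v|) ^ 7 * Real.exp (-v ^ 2 / 4)) := by
    intro v
    obtain ⟨⟨n0, n1, n2, n3⟩, hz⟩ := hb (l * v)
    rcases lt_or_ge R |l * v| with hv | hv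
    · obtain ⟨z0, z1, z2, z3⟩ := hz hv
      rw [z0, z1, z2, z3]
      simp only [mul_zero, add_zero, norm_zero]
      constructor <;> positivity
    · obtain ⟨e0, e1, e2, e3⟩ := E_bounds hX hY hp1 hp2 hK hδ hδ1 hc (Q v hv)
      set q := 15 * (K + 3) ^ 3 * (2 * K * δ ^ p) * (1 + |v|) ^ 7 * Real.exp (-v ^ 2 / 4) with hq
      have hq0 : 0 ≤ q := by positivity
      have hL3 : 1 ≤ L ^ 3 := one_le_pow₀ hL1
      have eq : A * δ ^ p * ((1 + |v|) ^ 7 * Real.exp (-v ^ 2 / 4)) = 8 * (q * (N * L ^ 3)) := by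
        rw [hA, hq]; ring
      have t0 : ∀ x : ℂ, ‖x‖ ≤ q → ∀ y : ℂ, ‖y‖ ≤ N → ∀ j : ℕ, j ≤ 3 →
          ‖x * (l ^ j * y)‖ ≤ q * (N * L ^ 3) := by
        intro x hx y hy j hj
        rw [norm_mul, norm_mul, norm_pow, Complex.norm_real, Real.norm_of_nonneg hl0.le, mul_comm N]
        have : l ^ j ≤ L ^ 3 := (pow_le_pow_left₀ hl0.le hlL j).trans (pow_le_pow_right₀ hL1 hj)
        gcongr
      have u0 := t0 _ e0 _ n0 0 (by norm_num)
      have u1 := t0 _ e3 _ n0 0 (by norm_num)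
      have u2 := t0 _ e2 _ n1 1 (by norm_num)
      have u3 := t0 _ e1 _ n2 2 (by norm_num)
      have u4 := t0 _ e0 _ n3 3 (by norm_num)
      have hp : 0 ≤ q * (N * L ^ 3) := by positivity
      rw [eq]
      simp only [pow_zero, one_mul, pow_one] at u0 u1 u2
      refine ⟨u0.trans (by linarith only [hp]), ?_⟩
      refine (norm_add_le _ _).trans ?_
      refine (add_le_add_left (norm_add₃_le) _).trans ?_
      rw [mul_assoc 3 (F2 v), mul_assoc 3 (F1 v), norm_mul 3, norm_mul 3, Complex.norm_ofNat]
      linarith only [u1, u2, u3, u4]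
  have sq : ∀ f : ℝ → ℂ, (∀ v, ‖f v‖ ≤ A * δ ^ p * ((1 + |v|) ^ 7 * Real.exp (-v ^ 2 / 4))) →
      ∫ v, ‖f v‖ ^ 2 ≤ (A' * δ ^ p) ^ 2 := by
    intro f hf
    calc ∫ v, ‖f v‖ ^ 2 ≤ ∫ v : ℝ, (A * δ ^ p) ^ 2 * ((1 + |v|) ^ 7 * Real.exp (-v ^ 2 / 4)) ^ 2 := by
          refine integral_mono_of_nonneg (Eventually.of_forall fun v => by positivity)
            (integrable_W.const_mul _) (Eventually.of_forall fun v => ?_)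
          simp only
          rw [← mul_pow]
          exact pow_le_pow_left₀ (norm_nonneg _) (hf v) 2
      _ = (A * δ ^ p) ^ 2 * I0 := integral_const_mul _ _
      _ ≤ (A * δ ^ p) ^ 2 * (I0 + 1) := by gcongr; linarith
      _ = _ := by
        
        have hs : Real.sqrt (I0 + 1) ^ 2 = I0 + 1 := Real.sq_sqrt (by linarith)
        
        calc (A * δ ^ p) ^ 2 * (I0 + 1) = (A * δ ^ p) ^ 2 * Real.sqrt (I0 + 1) ^ 2 := by rw [hs]
          _ = _ := by rw [hA']; ring
  have FM := fourier_moment p hp1 hp2 (fun v => F0 v * g (l * v))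
    (fun v => F1 v * g (l * v) + F0 v * (l * g1 (l * v)))
    (fun v => F2 v * g (l * v) + 2 * F1 v * (l * g1 (l * v)) + F0 v * (l ^ 2 * g2 (l * v)))
    (fun v => F3 v * g (l * v) + 3 * F2 v * (l * g1 (l * v)) + 3 * F1 v * (l ^ 2 * g2 (l * v)) +
        F0 v * (l ^ 3 * g3 (l * v)))
    ((hX.smooth.cexp.sub hY.smooth.cexp).mul (hg.comp (contDiff_const.mul contDiff_id)))
    (HasCompactSupport.mul_left (f := F0) (f' := fun v => g (l * v))
      (hgs.comp_homeomorph (Homeomorph.mulLeft₀ l hl0.ne')))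
    (fun v => (D1 v).mul (G1 v))
    (fun v => ?_) (fun v => ?_) (A' * δ ^ p) (by positivity) (sq _ fun v => (bound v).1)
    (sq _ fun v => (bound v).2)
  · refine (W_smooth hp1 hp2 g k (hg.continuous.integrable_of_hasCompactSupport hgs) hg.continuous
      hk0 hkc hk hki hk1 hk2 μ ν l hl0).trans ?_
    simp_rw [hμ, hν]
    rw [add_mul, ENNReal.ofReal_add (by positivity) (by positivity)]
    refine add_le_add ?_ ?_
    · rw [show 2 * (L * m) * δ = 2 * ((L * δ) * m) by ring, ENNReal.ofReal_mul (p := 2) (by norm_num), ENNReal.ofReal_ofNat]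
    · refine (ENNReal.rpow_le_rpow (mul_le_mul_right (mul_le_mul_right FM _) _)
        (by positivity)).trans (le_of_eq ?_)
      rw [← ENNReal.ofReal_ofNat 2, ENNReal.ofReal_rpow_of_nonneg (by norm_num) (by linarith),
        ← ENNReal.ofReal_mul (by positivity), ← ENNReal.ofReal_mul (by positivity),
        ENNReal.ofReal_rpow_of_nonneg (by positivity) (by positivity)]
      congr 1
      rw [show (2 : ℝ) ^ p * (2 * (5 * (A' * δ ^ p))) = (2 ^ p * (2 * (5 * A'))) * δ ^ p by ring,
        Real.mul_rpow (by positivity) (by positivity), ← Real.rpow_mul hδ.le,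
        mul_one_div_cancel (by linarith), Real.rpow_one]
  · convert! ((D2 v).mul (G1 v)).add ((D1 v).mul ((G2 v).const_mul (l : ℂ))) using 1
    ring
  · convert! (((D3 v).mul (G1 v)).add (((D2 v).const_mul 2).mul ((G2 v).const_mul (l : ℂ)))).add
      ((D1 v).mul ((G3 v).const_mul ((l : ℂ) ^ 2))) using 1
    ring

end Part6


section Part7
open Filter Topology
open scoped FourierTransform ContDiff

noncomputable def wY (b u : ℝ) : ℂ := 1 - 2 * Complex.I * b * u
noncomputable def Y0 (a b u : ℝ) : ℂ :=
  -(Complex.log (wY b u)) / 2 - Complex.I * b * u - a ^ 2 * u ^ 2 / (2 * wY b u)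
noncomputable def Y1f (a b u : ℝ) : ℂ :=
  Complex.I * b * (wY b u)⁻¹ - Complex.I * b -
    a ^ 2 * (u * (wY b u)⁻¹ + Complex.I * b * u ^ 2 * (wY b u)⁻¹ ^ 2)
noncomputable def Y2f (a b u : ℝ) : ℂ := -2 * b ^ 2 * (wY b u)⁻¹ ^ 2 - a ^ 2 * (wY b u)⁻¹ ^ 3
noncomputable def Y3f (a b u : ℝ) : ℂ :=
  -8 * Complex.I * b ^ 3 * (wY b u)⁻¹ ^ 3 - 6 * Complex.I * a ^ 2 * b * (wY b u)⁻¹ ^ 4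

lemma wY_re (b u : ℝ) : (wY b u).re = 1 := by
  simp [wY]

lemma wY_ne (b u : ℝ) : wY b u ≠ 0 := fun h => by
  have := wY_re b u; rw [h] at this; simp at this

lemma wY_deriv (b u : ℝ) : HasDerivAt (wY b) (-2 * Complex.I * b) u := by
  have h0 : HasDerivAt (fun u : ℝ => (u : ℂ)) 1 u := by
    simpa using (hasDerivAt_id u).ofReal_comp
  convert! (h0.const_mul (2 * Complex.I * b)).const_sub 1 using 1
  ring

lemma wY_inv_deriv (b u : ℝ) : HasDerivAt (fun u => (wY b u)⁻¹)
    (2 * Complex.I * b * (wY b u)⁻¹ ^ 2) u := by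
  convert! (wY_deriv b u).inv (wY_ne b u) using 1
  have := wY_ne b u
  field_simp

lemma wY_smooth (b : ℝ) : ContDiff ℝ ∞ (fun u => (wY b u)⁻¹) := by
  refine ContDiff.inv ?_ (wY_ne b)
  unfold wY
  exact contDiff_const.sub (contDiff_const.mul Complex.ofRealCLM.contDiff)

lemma wY_inv_norm (b u : ℝ) : ‖(wY b u)⁻¹‖ ≤ 1 := by
  rw [norm_inv]
  apply inv_le_one_of_one_le₀
  have := Complex.abs_re_le_norm (wY b u)
  rwa [wY_re, abs_one] at this

lemma wY_pow (b u p : ℝ) (hp1 : 1 ≤ p) (hp2 : p ≤ 2) (k : ℕ) :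
    ‖(wY b u)⁻¹ ^ k - 1‖ ≤ k * (2 * (|b| * |u|) ^ (p - 1)) := by
  set r := (wY b u)⁻¹ with hr
  have h1 : ‖r‖ ≤ 1 := wY_inv_norm b u
  have e : r - 1 = r * (2 * Complex.I * b * u) := by
    rw [hr]; have := wY_ne b u
    field_simp; rw [wY]; ring
  have h2 : ‖r - 1‖ ≤ 2 * (|b| * |u|) := by
    rw [e, norm_mul]
    have : ‖2 * Complex.I * (b : ℂ) * u‖ = 2 * (|b| * |u|) := by simp [mul_assoc]
    rw [this]
    exact mul_le_of_le_one_left (by positivity) h1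
  have h3 : ‖r - 1‖ ≤ 2 := (norm_sub_le _ _).trans (by rw [norm_one]; linarith)
  have h4 : ‖r - 1‖ ≤ 2 * (|b| * |u|) ^ (p - 1) := by
    have hx : 0 ≤ |b| * |u| := by positivity
    rcases le_total (|b| * |u|) 1 with h | h
    · refine h2.trans ?_
      gcongr
      have := Real.rpow_le_rpow_of_exponent_ge_of_imp hx h (y := 1) (z := p - 1) (by linarith)
        (by intro _ h; norm_num at h)
      simpa using this
    · have := Real.one_le_rpow h (z := p - 1) (by linarith)
      linarith
  induction k with
  | zero => simp
  | succ k ih =>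
    rw [show r ^ (k + 1) - 1 = r * (r ^ k - 1) + (r - 1) by ring]
    refine (norm_add_le _ _).trans ?_
    rw [norm_mul]
    have : ‖r‖ * ‖r ^ k - 1‖ ≤ ‖r ^ k - 1‖ := mul_le_of_le_one_left (norm_nonneg _) h1
    push_cast
    linarith

lemma Y_adm {p a b c δ : ℝ} (hp1 : 1 ≤ p) (hp2 : p ≤ 2) (hab : a ^ 2 + 2 * b ^ 2 = 1)
    (hbδ : |b| ≤ δ) (hc : 6 * b - 4 * b ^ 3 = c) :
    Adm p 96 δ c (Y0 a b) (Y1f a b) (Y2f a b) (Y3f a b) := by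
  have h0 : ∀ u : ℝ, HasDerivAt (fun u : ℝ => (u : ℂ)) 1 u := fun u => by
    simpa using (hasDerivAt_id u).ofReal_comp
  have h1 : ∀ u, HasDerivAt (Y0 a b) (Y1f a b u) u := by
    intro u
    have hl := (wY_deriv b u).clog_real (Or.inl (by rw [wY_re]; norm_num))
    have hh := ((hl.neg.div_const 2).sub ((h0 u).const_mul (Complex.I * b))).sub
      ((((h0 u).pow 2).const_mul (a ^ 2 / 2 : ℂ)).mul (wY_inv_deriv b u))
    have hw := wY_ne b u
    convert! hh using 1
    · ext v
      have hw := wY_ne b v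
      simp only [Y0, Pi.sub_apply, Pi.mul_apply, Pi.neg_apply, Pi.pow_apply]
      field_simp
    · simp only [Y1f, Pi.pow_apply]
      field_simp
      push_cast
      ring
  have h2 : ∀ u, HasDerivAt (Y1f a b) (Y2f a b u) u := by
    intro u
    have hi := wY_inv_deriv b u
    have hh := ((hi.const_mul (Complex.I * b)).sub_const (Complex.I * b)).sub
      ((((h0 u).mul hi).add ((((h0 u).pow 2).const_mul (Complex.I * b)).mul (hi.pow 2))).const_mul
        (a ^ 2 : ℂ))
    have hw := wY_ne b u
    convert! hh using 1
    simp only [Y2f]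
    have hI : Complex.I ^ 2 = -1 := Complex.I_sq
    have e : 2 * Complex.I * b * u = 1 - wY b u := by rw [wY]; ring
    set r := (wY b u)⁻¹ with hr
    have hrw : wY b u = r⁻¹ := by rw [hr, inv_inv]
    have hr0 : r ≠ 0 := inv_ne_zero hw
    have e' : 2 * Complex.I * b * u * r = r - 1 := by rw [e, hrw]; field_simp
    simp only [Pi.pow_apply]
    push_cast
    linear_combination (-2 * b ^ 2 * r ^ 2) * hI + (a ^ 2 * r * (2 * Complex.I * b * u * r + 1 + r)) * e'
  have h3 : ∀ u, HasDerivAt (Y2f a b) (Y3f a b u) u := by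
    intro u
    have hi := wY_inv_deriv b u
    have hh := ((hi.pow 2).const_mul (-2 * b ^ 2 : ℂ)).sub ((hi.pow 3).const_mul (a ^ 2 : ℂ))
    convert! hh using 1
    simp only [Y3f]
    push_cast
    ring
  refine ⟨h1, h2, h3, ?_, by simp [Y0, wY], by simp [Y1f, wY], ?_, ?_⟩
  · rw [contDiff_infty_iff_deriv]
    refine ⟨fun u => (h1 u).differentiableAt, ?_⟩
    rw [show deriv (Y0 a b) = Y1f a b from funext fun u => (h1 u).deriv]
    have hs := wY_smooth b
    have ho : ContDiff ℝ ∞ (fun u : ℝ => (u : ℂ)) := Complex.ofRealCLM.contDiff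
    unfold Y1f
    exact ((contDiff_const.mul hs).sub contDiff_const).sub (contDiff_const.mul
      ((ho.mul hs).add ((contDiff_const.mul (ho.pow 2)).mul (hs.pow 2))))
  · have : ((a ^ 2 + 2 * b ^ 2 : ℝ) : ℂ) = 1 := by rw [hab]; simp
    push_cast at this
    simp [Y2f, wY]
    linear_combination -this
  · intro u
    have hc' : (c : ℂ) = 8 * b ^ 3 + 6 * a ^ 2 * b := by
      have : c = 8 * b ^ 3 + 6 * a ^ 2 * b := by
        rw [← hc]; linear_combination (-6 * b) * hab
      rw [this]; push_cast; ring
    have e : Y3f a b u + c * Complex.I = ((b * -(8 * b ^ 2) : ℝ) : ℂ) * Complex.I * ((wY b u)⁻¹ ^ 3 - 1) +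
        ((b * -(6 * a ^ 2) : ℝ) : ℂ) * Complex.I * ((wY b u)⁻¹ ^ 4 - 1) := by
      rw [hc', Y3f]; push_cast; ring
    have k3 := wY_pow b u p hp1 hp2 3
    have k4 := wY_pow b u p hp1 hp2 4
    rw [e]
    refine (norm_add_le _ _).trans ?_
    simp only [norm_mul, Complex.norm_real, Complex.norm_I, mul_one, Real.norm_eq_abs, abs_neg, abs_mul]
    have ha1 : a ^ 2 ≤ 1 := by nlinarith [sq_nonneg b]
    have hb1 : b ^ 2 ≤ 1 := by nlinarith [sq_nonneg a]
    have a8 : |(8 : ℝ)| = 8 := by norm_num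
    have a6 : |(6 : ℝ)| = 6 := by norm_num
    rw [a8, a6, abs_of_nonneg (sq_nonneg a), abs_of_nonneg (sq_nonneg b)]
    have hbp : |b| * |b| ^ (p - 1) ≤ δ ^ p := by
      have : |b| * |b| ^ (p - 1) = |b| ^ p := by
        rw [← Real.rpow_one_add' (abs_nonneg b) (by linarith)]; congr 1; ring
      rw [this]; gcongr
    calc _ ≤ |b| * (8 * 1) * ((3 : ℕ) * (2 * (|b| * |u|) ^ (p - 1))) +
          |b| * (6 * 1) * ((4 : ℕ) * (2 * (|b| * |u|) ^ (p - 1))) := by gcongr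
      _ = 96 * (|b| * |b| ^ (p - 1)) * |u| ^ (p - 1) := by
        rw [Real.mul_rpow (abs_nonneg _) (abs_nonneg _)]; push_cast; ring
      _ ≤ _ := by gcongr

lemma Y_charFun (a b u : ℝ) :
    ∫ x, Complex.exp ((u * (a * x + b * (x ^ 2 - 1)) : ℝ) * Complex.I) ∂(gaussianReal 0 1) =
      Complex.exp (Y0 a b u) := by
  rw [integral_gaussianReal_eq_integral_smul one_ne_zero]
  have hw := wY_ne b u
  have e : ∀ x : ℝ, gaussianPDFReal 0 1 x •
      Complex.exp ((u * (a * x + b * (x ^ 2 - 1)) : ℝ) * Complex.I) =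
      ((Real.sqrt (2 * Real.pi))⁻¹ : ℝ) * Complex.exp ((-(wY b u) / 2) * x ^ 2 +
        (Complex.I * u * a) * x + (-(Complex.I * u * b))) := by
    intro x
    rw [gaussianPDFReal_def, Complex.real_smul]
    simp only [NNReal.coe_one, mul_one, sub_zero]
    rw [Complex.ofReal_mul, mul_assoc, Complex.ofReal_exp, ← Complex.exp_add]
    congr 2
    rw [wY]; push_cast; ring
  simp_rw [e]
  rw [integral_const_mul, integral_cexp_quadratic (by norm_num [wY_re])]
  have hpi : (0 : ℝ) < 2 * Real.pi := by positivity
  have e1 : ((Real.pi : ℂ) / -(-(wY b u) / 2)) = ((2 * Real.pi : ℝ) : ℂ) * (wY b u)⁻¹ := by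
    push_cast; field_simp
  have e2 : ((Real.sqrt (2 * Real.pi))⁻¹ : ℝ) = Real.exp (-(Real.log (2 * Real.pi) / 2)) := by
    rw [Real.exp_neg, Real.sqrt_eq_rpow, Real.rpow_def_of_pos hpi]; congr 2; ring
  rw [e1, Complex.cpow_def_of_ne_zero (mul_ne_zero (by exact_mod_cast hpi.ne') (inv_ne_zero hw)),
    Complex.log_ofReal_mul hpi (inv_ne_zero hw), Complex.log_inv, e2, Complex.ofReal_exp,
    ← Complex.exp_add, ← Complex.exp_add]
  · congr 1
    rw [Y0]
    have hI : Complex.I ^ 2 = -1 := Complex.I_sq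
    field_simp
    push_cast
    ring_nf
    rw [hI]
    ring
  · intro h
    have := Complex.arg_eq_pi_iff.1 h
    rw [wY_re] at this
    linarith [this.1]

lemma ex_b {c : ℝ} (hc : |c| ≤ 1) : ∃ b : ℝ, |b| ≤ 1 / 2 ∧ |b| ≤ |c| ∧ 6 * b - 4 * b ^ 3 = c := by
  have hcont : ContinuousOn (fun b : ℝ => 6 * b - 4 * b ^ 3) (Set.Icc (-(1 / 2)) (1 / 2)) := by fun_prop
  have := intermediate_value_Icc (by norm_num) hcont
  obtain ⟨h1, h2⟩ := abs_le.1 hc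
  obtain ⟨b, hb, hbc⟩ := this (show c ∈ _ from ⟨by norm_num; linarith, by norm_num; linarith⟩)
  have hb' : |b| ≤ 1 / 2 := abs_le.2 hb
  simp only at hbc
  refine ⟨b, hb', ?_, hbc⟩
  have hb2 : b ^ 2 ≤ 1 / 4 := by rw [← sq_abs]; nlinarith [abs_nonneg b]
  have : |c| = |b| * (6 - 4 * b ^ 2) := by
    rw [← hbc, show 6 * b - 4 * b ^ 3 = b * (6 - 4 * b ^ 2) by ring, abs_mul,
      abs_of_nonneg (a := 6 - 4 * b ^ 2) (by linarith)]
  rw [this]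
  exact le_mul_of_one_le_right (abs_nonneg _) (by linarith)

theorem ex_Y (p : ℝ) (hp1 : 1 ≤ p) (hp2 : p ≤ 2) : ∃ C > (0 : ℝ), ∀ δ c : ℝ,
    0 < δ → δ ≤ 1 → |c| ≤ δ → ∃ Y Y1 Y2 Y3 : ℝ → ℂ, ∃ ν : Measure ℝ, IsProbabilityMeasure ν ∧
      Adm p 96 δ c Y Y1 Y2 Y3 ∧ (∀ v, charFun ν (2 * Real.pi * v) = Complex.exp (Y v)) ∧
      wasserstein p ν ((gaussianReal 0 1).map fun x => (2 * Real.pi)⁻¹ * x) ≤ ENNReal.ofReal (C * δ) := by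
  set I := ∫ x : ℝ, (2 * x ^ 4 + 2) ∂(gaussianReal 0 1) with hI
  have i4 : Integrable (fun x : ℝ => 2 * x ^ 4 + 2) (gaussianReal 0 1) := by
    have := (memLp_id_gaussianReal' (μ := 0) (v := 1) (4 : ℕ) (by simp)).integrable_norm_pow (by norm_num)
    refine ((this.const_mul 2).add (integrable_const 2)).congr (Eventually.of_forall fun x => ?_)
    simp [(show Even 4 by decide).pow_abs]
  have hI0 : 0 ≤ I := integral_nonneg fun x => by positivity
  refine ⟨Real.sqrt I + 1, by positivity, ?_⟩
  intro δ c hδ hδ1 hc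
  obtain ⟨b, hb, hbc, hbe⟩ := ex_b (hc.trans hδ1)
  have hb2 : b ^ 2 ≤ 1 / 4 := by rw [← sq_abs]; nlinarith [abs_nonneg b]
  set a := Real.sqrt (1 - 2 * b ^ 2) with ha
  have ha2 : a ^ 2 = 1 - 2 * b ^ 2 := Real.sq_sqrt (by linarith)
  have ha0 : 0 ≤ a := Real.sqrt_nonneg _
  have hpi : (0 : ℝ) < 2 * Real.pi := by positivity
  have hm : Measurable fun x : ℝ => (2 * Real.pi)⁻¹ * (a * x + b * (x ^ 2 - 1)) := by fun_prop
  refine ⟨_, _, _, _, (gaussianReal 0 1).map fun x : ℝ => (2 * Real.pi)⁻¹ * (a * x + b * (x ^ 2 - 1)),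
    Measure.isProbabilityMeasure_map hm.aemeasurable,
    Y_adm (a := a) hp1 hp2 (by linarith) (hbc.trans hc) hbe, ?_, ?_⟩
  · intro v
    rw [← Y_charFun, charFun_eq, integral_map hm.aemeasurable (by fun_prop)]
    congr 1; ext x
    congr 3
    field_simp
  · refine (W_le_map _ hm (by fun_prop)).trans ?_
    refine (lp_le_l2 hp1 hp2 _ (X := fun w => (2 * Real.pi)⁻¹ * (a * w + b * (w ^ 2 - 1)) -
      (2 * Real.pi)⁻¹ * w) (by fun_prop)).trans ?_
    have hl : ∫⁻ x : ℝ, ENNReal.ofReal (((2 * Real.pi)⁻¹ * (a * x + b * (x ^ 2 - 1)) -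
      (2 * Real.pi)⁻¹ * x) ^ 2) ∂(gaussianReal 0 1) ≤ ENNReal.ofReal (δ ^ 2 * I) := by
      rw [hI, ← integral_const_mul, ofReal_integral_eq_lintegral_ofReal (i4.const_mul _)
        (Eventually.of_forall fun x => by positivity)]
      refine lintegral_mono fun x => ENNReal.ofReal_le_ofReal ?_
      have h1 : (2 * Real.pi)⁻¹ ≤ 1 := inv_le_one_of_one_le₀ (by linarith [Real.pi_gt_three])
      have h1' : ((2 * Real.pi)⁻¹) ^ 2 ≤ 1 := pow_le_one₀ (by positivity) h1
      have hbδ : b ^ 2 ≤ δ ^ 2 := sq_le_sq.2 (by rw [abs_of_pos hδ]; exact hbc.trans hc)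
      have ha1 : a ≤ 1 := by nlinarith
      have h2 : 1 - a ≤ 2 * b ^ 2 := by nlinarith
      have h3 : (1 - a) ^ 2 ≤ b ^ 2 := by nlinarith
      calc ((2 * Real.pi)⁻¹ * (a * x + b * (x ^ 2 - 1)) - (2 * Real.pi)⁻¹ * x) ^ 2
          = ((2 * Real.pi)⁻¹) ^ 2 * ((a - 1) * x + b * (x ^ 2 - 1)) ^ 2 := by ring
        _ ≤ 1 * ((a - 1) * x + b * (x ^ 2 - 1)) ^ 2 := by gcongr
        _ ≤ 2 * (1 - a) ^ 2 * x ^ 2 + 2 * b ^ 2 * (x ^ 2 - 1) ^ 2 := by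
          linarith [sq_nonneg ((a - 1) * x - b * (x ^ 2 - 1))]
        _ ≤ 2 * b ^ 2 * x ^ 2 + 2 * b ^ 2 * (x ^ 2 - 1) ^ 2 := by gcongr
        _ ≤ b ^ 2 * (2 * x ^ 4 + 2) := by nlinarith [mul_nonneg (sq_nonneg b) (sq_nonneg x)]
        _ ≤ _ := by gcongr
    refine (ENNReal.rpow_le_rpow hl (by norm_num)).trans ?_
    rw [ENNReal.ofReal_rpow_of_nonneg (by positivity) (by norm_num), ← Real.sqrt_eq_rpow,
      Real.sqrt_mul (by positivity), Real.sqrt_sq hδ.le]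
    apply ENNReal.ofReal_le_ofReal
    nlinarith

end Part7


section Part8
open Filter Topology
open scoped FourierTransform ContDiff

noncomputable def Gn (η : Measure ℝ) (n : ℕ) (u : ℝ) : ℂ :=
  ∫ x, (Complex.I * x) ^ n * x ^ 2 * Complex.exp ((u * x : ℝ) * Complex.I) ∂η

lemma norm_cexp_I (y : ℝ) : ‖Complex.exp (y * Complex.I)‖ = 1 := Complex.norm_exp_ofReal_mul_I y

lemma cexp_deriv (x u : ℝ) : HasDerivAt (fun u : ℝ => Complex.exp ((u * x : ℝ) * Complex.I))
    (Complex.I * x * Complex.exp ((u * x : ℝ) * Complex.I)) u := by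
  have h0 : HasDerivAt (fun u : ℝ => ((u * x : ℝ) : ℂ) * Complex.I) ((x : ℂ) * Complex.I) u := by
    have : HasDerivAt (fun u : ℝ => u * x) x u := by simpa using (hasDerivAt_id u).mul_const x
    exact this.ofReal_comp.mul_const _
  convert! h0.cexp using 1
  ring

lemma Gn_integrable {η : Measure ℝ} (h2 : Integrable (fun x => x ^ 2) η)
    (h1 : ∀ᵐ x ∂η, |x| ≤ 1) (n : ℕ) (u : ℝ) :
    Integrable (fun x : ℝ => (Complex.I * x) ^ n * (x : ℂ) ^ 2 * Complex.exp ((u * x : ℝ) * Complex.I)) η := by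
  refine h2.mono' (by fun_prop) ?_
  filter_upwards [h1] with x hx
  rw [norm_mul, norm_mul, norm_pow, norm_mul, Complex.norm_I, one_mul, norm_pow, norm_cexp_I, mul_one,
    Complex.norm_real, Real.norm_eq_abs, sq_abs]
  exact mul_le_of_le_one_left (sq_nonneg x) (pow_le_one₀ (abs_nonneg x) hx)

lemma Gn_deriv {η : Measure ℝ} (h2 : Integrable (fun x => x ^ 2) η)
    (h1 : ∀ᵐ x ∂η, |x| ≤ 1) (n : ℕ) (u : ℝ) : HasDerivAt (Gn η n) (Gn η (n + 1) u) u := by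
  refine (hasDerivAt_integral_of_dominated_loc_of_deriv_le
    (F := fun (u x : ℝ) => (Complex.I * x) ^ n * (x : ℂ) ^ 2 * Complex.exp ((u * x : ℝ) * Complex.I))
    (F' := fun (u x : ℝ) => (Complex.I * x) ^ (n + 1) * (x : ℂ) ^ 2 * Complex.exp ((u * x : ℝ) * Complex.I))
    (bound := fun x => x ^ 2) (Metric.ball_mem_nhds u one_pos)
    (Eventually.of_forall fun v => (Gn_integrable h2 h1 n v).aestronglyMeasurable)
    (Gn_integrable h2 h1 n u) (Gn_integrable h2 h1 (n + 1) u).aestronglyMeasurable ?_ h2 ?_).2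
  · filter_upwards [h1] with x hx v _
    rw [norm_mul, norm_mul, norm_pow, norm_mul, Complex.norm_I, one_mul, norm_pow, norm_cexp_I, mul_one,
      Complex.norm_real, Real.norm_eq_abs, sq_abs]
    exact mul_le_of_le_one_left (sq_nonneg x) (pow_le_one₀ (abs_nonneg x) hx)
  · refine Eventually.of_forall fun x v _ => ?_
    convert! (cexp_deriv x v).const_mul ((Complex.I * x) ^ n * (x : ℂ) ^ 2) using 1
    ring

lemma Gn_smooth {η : Measure ℝ} (h2 : Integrable (fun x => x ^ 2) η)
    (h1 : ∀ᵐ x ∂η, |x| ≤ 1) : ContDiff ℝ ∞ (Gn η 0) := by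
  have : ∀ m n : ℕ, ContDiff ℝ m (Gn η n) := by
    intro m
    induction m with
    | zero => intro n; exact contDiff_zero.2 (continuous_iff_continuousAt.2
        fun u => (Gn_deriv h2 h1 n u).continuousAt)
    | succ m ih =>
      intro n
      push_cast
      rw [contDiff_succ_iff_deriv]
      refine ⟨fun u => (Gn_deriv h2 h1 n u).differentiableAt, by simp, ?_⟩
      rw [show deriv (Gn η n) = Gn η (n + 1) from funext fun u => (Gn_deriv h2 h1 n u).deriv]
      exact ih _
  exact contDiff_infty.2 fun m => this m 0

noncomputable def Phi (η : Measure ℝ) (u : ℝ) : ℂ := ∫ x, lkIntegrandC u x ∂η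
noncomputable def Phi1 (η : Measure ℝ) (u : ℝ) : ℂ :=
  ∫ x, Complex.I * x * (Complex.exp ((u * x : ℝ) * Complex.I) - 1) ∂η

lemma Phi1_bound (u x : ℝ) : ‖Complex.I * x * (Complex.exp ((u * x : ℝ) * Complex.I) - 1)‖ ≤ |u| * x ^ 2 := by
  rw [norm_mul, norm_mul, Complex.norm_I, one_mul, Complex.norm_real, Real.norm_eq_abs]
  have := norm_cexp_sub_one_le (u * x)
  rw [abs_mul] at this
  calc _ ≤ |x| * (|u| * |x|) := by gcongr
    _ = |u| * |x| ^ 2 := by ring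
    _ = _ := by rw [sq_abs]

lemma Phi1_integrable {η : Measure ℝ} (h2 : Integrable (fun x => x ^ 2) η) (u : ℝ) :
    Integrable (fun x : ℝ => Complex.I * x * (Complex.exp ((u * x : ℝ) * Complex.I) - 1)) η :=
  (h2.const_mul |u|).mono' (by fun_prop) (Eventually.of_forall fun x => Phi1_bound u x)

lemma Phi_deriv {η : Measure ℝ} (h2 : Integrable (fun x => x ^ 2) η) (u : ℝ) :
    HasDerivAt (Phi η) (Phi1 η u) u := by
  refine (hasDerivAt_integral_of_dominated_loc_of_deriv_le
    (F := fun (u x : ℝ) => lkIntegrandC u x)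
    (F' := fun (u x : ℝ) => Complex.I * x * (Complex.exp ((u * x : ℝ) * Complex.I) - 1))
    (bound := fun x => (|u| + 1) * x ^ 2) (Metric.ball_mem_nhds u one_pos)
    (Eventually.of_forall fun v => (integrable_lk h2 v).aestronglyMeasurable)
    (integrable_lk h2 u) (Phi1_integrable h2 u).aestronglyMeasurable ?_ (h2.const_mul _) ?_).2
  · refine Eventually.of_forall fun x v hv => (Phi1_bound v x).trans ?_
    gcongr
    rw [Metric.mem_ball, Real.dist_eq] at hv
    have := abs_sub_abs_le_abs_sub v u
    linarith
  · refine Eventually.of_forall fun x v _ => ?_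
    have h0 : HasDerivAt (fun u : ℝ => ((u * x : ℝ) : ℂ) * Complex.I) ((x : ℂ) * Complex.I) v := by
      have : HasDerivAt (fun u : ℝ => u * x) x v := by simpa using (hasDerivAt_id v).mul_const x
      exact this.ofReal_comp.mul_const _
    convert! ((cexp_deriv x v).sub_const 1).sub h0 using 1
    ring

lemma Phi1_deriv {η : Measure ℝ} (h2 : Integrable (fun x => x ^ 2) η)
    (h1 : ∀ᵐ x ∂η, |x| ≤ 1) (u : ℝ) :
    HasDerivAt (Phi1 η) (-Gn η 0 u) u := by
  have hb : ∀ v x : ℝ, ‖-((x : ℂ) ^ 2 * Complex.exp ((v * x : ℝ) * Complex.I))‖ ≤ x ^ 2 := fun v x => by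
    rw [norm_neg, norm_mul, norm_pow, norm_cexp_I, mul_one, Complex.norm_real, Real.norm_eq_abs, sq_abs]
  have e : -Gn η 0 u = ∫ x : ℝ, -((x : ℂ) ^ 2 * Complex.exp ((u * x : ℝ) * Complex.I)) ∂η := by
    rw [integral_neg, Gn]; simp
  rw [e]
  refine (hasDerivAt_integral_of_dominated_loc_of_deriv_le
    (F := fun (u x : ℝ) => Complex.I * x * (Complex.exp ((u * x : ℝ) * Complex.I) - 1))
    (F' := fun (u x : ℝ) => -((x : ℂ) ^ 2 * Complex.exp ((u * x : ℝ) * Complex.I)))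
    (bound := fun x => x ^ 2) (Metric.ball_mem_nhds u one_pos)
    (Eventually.of_forall fun v => (Phi1_integrable h2 v).aestronglyMeasurable)
    (Phi1_integrable h2 u) (by fun_prop) ?_ h2 ?_).2
  · exact Eventually.of_forall fun x v hv => hb v x
  · refine Eventually.of_forall fun x v _ => ?_
    convert! ((cexp_deriv x v).sub_const 1).const_mul (Complex.I * x) using 1
    linear_combination (-(x : ℂ) ^ 2 * Complex.exp ((v * x : ℝ) * Complex.I)) * Complex.I_sq

lemma Phi_smooth {η : Measure ℝ} (h2 : Integrable (fun x => x ^ 2) η)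
    (h1 : ∀ᵐ x ∂η, |x| ≤ 1) : ContDiff ℝ ∞ (Phi η) := by
  rw [contDiff_infty_iff_deriv]
  refine ⟨fun u => (Phi_deriv h2 u).differentiableAt, ?_⟩
  rw [show deriv (Phi η) = Phi1 η from funext fun u => (Phi_deriv h2 u).deriv,
    contDiff_infty_iff_deriv]
  refine ⟨fun u => (Phi1_deriv h2 h1 u).differentiableAt, ?_⟩
  rw [show deriv (Phi1 η) = fun u => -Gn η 0 u from funext fun u => (Phi1_deriv h2 h1 u).deriv]
  exact (Gn_smooth h2 h1).neg

lemma cexp_sub_one_rpow {p : ℝ} (hp1 : 1 ≤ p) (hp2 : p ≤ 2) (y : ℝ) :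
    ‖Complex.exp (y * Complex.I) - 1‖ ≤ 2 * |y| ^ (p - 1) := by
  have h2 := norm_cexp_sub_one_le y
  have h3 : ‖Complex.exp (y * Complex.I) - 1‖ ≤ 2 :=
    (norm_sub_le _ _).trans (by rw [norm_one, norm_cexp_I]; norm_num)
  rcases le_total |y| 1 with h | h
  · have := Real.rpow_le_rpow_of_exponent_ge_of_imp (abs_nonneg y) h (y := 1) (z := p - 1) (by linarith)
      (by intro _ h; norm_num at h)
    rw [Real.rpow_one] at this
    linarith [abs_nonneg y]
  · have := Real.one_le_rpow h (z := p - 1) (by linarith)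
    linarith

lemma integrable_rpow {η : Measure ℝ} (h2 : Integrable (fun x => x ^ 2) η)
    (h1 : ∀ᵐ x ∂η, |x| ≤ 1) {q : ℝ} (hq : 0 ≤ q) : Integrable (fun x => |x| ^ (q + 2)) η := by
  refine h2.mono' (by fun_prop (disch := linarith)) ?_
  filter_upwards [h1] with x hx
  rw [Real.norm_of_nonneg (by positivity), Real.rpow_add' (abs_nonneg x) (by linarith), Real.rpow_two, sq_abs]
  exact mul_le_of_le_one_left (sq_nonneg x) (Real.rpow_le_one (abs_nonneg x) hx hq)

lemma Gn1_diff {η : Measure ℝ} (h2 : Integrable (fun x => x ^ 2) η)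
    (h1 : ∀ᵐ x ∂η, |x| ≤ 1) {p : ℝ} (hp1 : 1 ≤ p) (hp2 : p ≤ 2) (u : ℝ) :
    ‖Gn η 1 u - Complex.I * (∫ x, x ^ 3 ∂η : ℝ)‖ ≤ 2 * |u| ^ (p - 1) * ∫ x, |x| ^ (p + 2) ∂η := by
  have e0 : Complex.I * ((∫ x, x ^ 3 ∂η : ℝ) : ℂ) = Gn η 1 0 := by
    rw [Gn, ← integral_complex_ofReal, ← integral_const_mul]
    congr 1; ext x; simp; ring
  rw [e0, Gn, Gn, ← integral_sub (Gn_integrable h2 h1 1 u) (Gn_integrable h2 h1 1 0), ← integral_const_mul]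
  refine norm_integral_le_of_norm_le ((integrable_rpow h2 h1 (by linarith)).const_mul _)
    (Eventually.of_forall fun x => ?_)
  have hx : (Complex.I * x) ^ 1 * (x : ℂ) ^ 2 * Complex.exp ((u * x : ℝ) * Complex.I) -
      (Complex.I * x) ^ 1 * (x : ℂ) ^ 2 * Complex.exp ((0 * x : ℝ) * Complex.I) =
      (Complex.I * x * (x : ℂ) ^ 2) * (Complex.exp ((u * x : ℝ) * Complex.I) - 1) := by
    simp; ring
  rw [hx, norm_mul, norm_mul, norm_mul, Complex.norm_I, one_mul, norm_pow, Complex.norm_real, Real.norm_eq_abs]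
  have := cexp_sub_one_rpow hp1 hp2 (u * x)
  rw [abs_mul, Real.mul_rpow (abs_nonneg _) (abs_nonneg _)] at this
  calc _ ≤ |x| * |x| ^ 2 * (2 * (|u| ^ (p - 1) * |x| ^ (p - 1))) := by gcongr
    _ = 2 * |u| ^ (p - 1) * (|x| ^ (p - 1) * |x| ^ 3) := by ring
    _ = _ := by
      congr 1
      rw [show p + 2 = (p - 1) + (3 : ℕ) by push_cast; ring, Real.rpow_add_natCast' (abs_nonneg _)]
      push_cast; linarith

lemma third_le {η : Measure ℝ} (h2 : Integrable (fun x => x ^ 2) η)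
    (h1 : ∀ᵐ x ∂η, |x| ≤ 1) {p D s : ℝ} (hp1 : 1 ≤ p) (hD : 0 < D) (hs : s = ∫ x, x ^ 2 ∂η)
    (hP : ∫ x, |x| ^ (p + 2) ∂η = D ^ p * s) : |∫ x, x ^ 3 ∂η| ≤ D * s := by
  have i3 : Integrable (fun x => |x| * x ^ 2) η := by
    refine (integrable_rpow h2 h1 (q := 1) (by norm_num)).congr (Eventually.of_forall fun x => ?_)
    simp only
    rw [Real.rpow_add' (abs_nonneg x) (by norm_num), Real.rpow_one, Real.rpow_two, sq_abs]
  have k1 : |∫ x, x ^ 3 ∂η| ≤ ∫ x, |x| * x ^ 2 ∂η := by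
    refine (abs_integral_le_integral_abs).trans (le_of_eq ?_)
    congr 1; ext x
    rw [abs_pow, ← sq_abs x]; ring
  have ip := integrable_rpow h2 h1 (q := p) (by linarith)
  have k2 : ∫ x, p * D⁻¹ * (|x| * x ^ 2) ∂η ≤ ∫ x, ((D ^ p)⁻¹ * |x| ^ (p + 2) + (p - 1) * x ^ 2) ∂η := by
    refine integral_mono (i3.const_mul _) ((ip.const_mul _).add (h2.const_mul _)) fun x => ?_
    simp only
    have hy : 0 ≤ |x| / D := by positivity
    have hb := one_add_mul_self_le_rpow_one_add (s := |x| / D - 1) (by linarith) hp1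
    rw [add_sub_cancel, Real.div_rpow (abs_nonneg x) hD.le] at hb
    rw [Real.rpow_add' (abs_nonneg x) (by linarith), Real.rpow_two, sq_abs]
    have := mul_le_mul_of_nonneg_right hb (sq_nonneg x)
    rw [div_eq_mul_inv, div_eq_mul_inv] at this
    linarith
  rw [integral_const_mul, integral_add (ip.const_mul _) (h2.const_mul _), integral_const_mul,
    integral_const_mul, hP, ← hs, ← mul_assoc, inv_mul_cancel₀ (by positivity), one_mul] at k2
  refine k1.trans ?_
  have h3 : p * D⁻¹ * ∫ x, |x| * x ^ 2 ∂η ≤ p * D⁻¹ * (D * s) := by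
    have : p * D⁻¹ * (D * s) = p * s := by field_simp
    linarith
  exact le_of_mul_le_mul_left h3 (by positivity)

end Part8


section Part9
open Filter Topology
open scoped FourierTransform ContDiff

lemma levy_adm {η : Measure ℝ} (h2 : Integrable (fun x => x ^ 2) η)
    (h1 : ∀ᵐ x ∂η, |x| ≤ 1) {p D s t σ κ : ℝ} (hp1 : 1 ≤ p) (hp2 : p ≤ 2) (hD : 0 < D)
    (hs : s = ∫ x, x ^ 2 ∂η) (hs0 : 0 < s) (ht : 0 < t) (hκ : 0 < κ)
    (hS : κ ^ 2 * (t * (σ ^ 2 + s)) = 1)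
    (hP : ∫ x, |x| ^ (p + 2) ∂η = D ^ p * s) :
    Adm p 96 (κ * D) (t * κ ^ 3 * ∫ x, x ^ 3 ∂η)
      (fun v => (t : ℂ) * (((-((κ * v) ^ 2 * σ ^ 2) / 2 : ℝ) : ℂ) + Phi η (κ * v)))
      (fun v => (t : ℂ) * (-(κ ^ 2 * v * σ ^ 2) + κ * Phi1 η (κ * v)))
      (fun v => (t : ℂ) * (-(κ ^ 2 * σ ^ 2) - κ ^ 2 * Gn η 0 (κ * v)))
      (fun v => (t : ℂ) * (-(κ ^ 3 * Gn η 1 (κ * v)))) := by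
  have h0 : ∀ u : ℝ, HasDerivAt (fun u : ℝ => (u : ℂ)) 1 u := fun u => by
    simpa using (hasDerivAt_id u).ofReal_comp
  have hlin : ∀ u : ℝ, HasDerivAt (fun v : ℝ => κ * v) κ u := fun u => by
    simpa using (hasDerivAt_id u).const_mul κ
  have sc : ∀ f f1 : ℝ → ℂ, (∀ u, HasDerivAt f (f1 u) u) → ∀ u,
      HasDerivAt (fun v => f (κ * v)) (κ * f1 (κ * u)) u := by
    intro f f1 h u
    have := (h (κ * u)).scomp u (hlin u)
    simpa [Function.comp_def] using this
  have G1 := sc _ _ (Phi_deriv h2)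
  have G2 := sc _ _ (Phi1_deriv h2 h1)
  have G3 := sc _ _ (Gn_deriv h2 h1 0)
  have tks : t * κ ^ 2 * s ≤ 1 := by nlinarith [mul_nonneg (mul_nonneg (sq_nonneg κ) ht.le) (sq_nonneg σ)]
  refine ⟨fun u => ?_, fun u => ?_, fun u => ?_, ?_, ?_, ?_, ?_, fun u => ?_⟩
  · have hh := ((((h0 u).pow 2).const_mul (-(κ ^ 2 * σ ^ 2) / 2 : ℂ)).add (G1 u)).const_mul (t : ℂ)
    convert! hh using 1
    · ext v
      simp only [Pi.add_apply, Pi.pow_apply]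
      push_cast; ring
    · push_cast; ring
  · have hh := (((h0 u).const_mul (-(κ ^ 2 * σ ^ 2) : ℂ)).add ((G2 u).const_mul (κ : ℂ))).const_mul (t : ℂ)
    convert! hh using 1
    · ext v
      simp only [Pi.add_apply]
      ring
    · ring
  · have hh := (((G3 u).const_mul (κ ^ 2 : ℂ)).const_sub (-(κ ^ 2 * σ ^ 2) : ℂ)).const_mul (t : ℂ)
    convert! hh using 1
    ring
  · refine contDiff_const.mul (ContDiff.add ?_ ((Phi_smooth h2 h1).comp (contDiff_const.mul contDiff_id)))
    refine Complex.ofRealCLM.contDiff.comp ?_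
    exact ((((contDiff_const.mul contDiff_id).pow 2).mul contDiff_const).neg).div_const 2
  · simp [Phi, lkIntegrandC]
  · simp [Phi1]
  · have e : Gn η 0 (κ * 0) = (s : ℂ) := by
      rw [hs, ← integral_complex_ofReal, Gn]; simp
    rw [e]
    have : ((κ ^ 2 * (t * (σ ^ 2 + s)) : ℝ) : ℂ) = 1 := by rw [hS]; simp
    push_cast at this
    linear_combination -this
  · have hd := Gn1_diff h2 h1 hp1 hp2 (κ * u)
    have e : (t : ℂ) * (-(κ ^ 3 * Gn η 1 (κ * u))) + ((t * κ ^ 3 * ∫ x, x ^ 3 ∂η : ℝ) : ℂ) * Complex.I =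
        ((-(t * κ ^ 3) : ℝ) : ℂ) * (Gn η 1 (κ * u) - Complex.I * (∫ x, x ^ 3 ∂η : ℝ)) := by
      push_cast; ring
    rw [e, norm_mul, Complex.norm_real, Real.norm_eq_abs, abs_neg, abs_of_pos (by positivity)]
    rw [hP, abs_mul, abs_of_pos hκ, Real.mul_rpow hκ.le (abs_nonneg u)] at hd
    have ek : κ * κ ^ (p - 1) = κ ^ p := by
      rw [← Real.rpow_one_add' hκ.le (by linarith)]; congr 1; ring
    calc _ ≤ t * κ ^ 3 * (2 * (κ ^ (p - 1) * |u| ^ (p - 1)) * (D ^ p * s)) := by gcongr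
      _ = (t * κ ^ 2 * s) * (2 * ((κ * κ ^ (p - 1)) * D ^ p) * |u| ^ (p - 1)) := by ring
      _ ≤ 1 * (2 * ((κ * κ ^ (p - 1)) * D ^ p) * |u| ^ (p - 1)) := by gcongr
      _ ≤ 96 * (κ * D) ^ p * |u| ^ (p - 1) := by
        rw [ek, ← Real.mul_rpow hκ.le hD.le, one_mul]
        gcongr
        norm_num

lemma W_small {η : Measure ℝ} (h2 : Integrable (fun x => x ^ 2) η)
    {p s t σ : ℝ} (hp1 : 1 ≤ p) (hp2 : p ≤ 2)
    (hs : s = ∫ x, x ^ 2 ∂η) (hs0 : 0 < s) (ht : 0 < t) (hσ : 0 ≤ σ)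
    (μ : Measure ℝ) [IsProbabilityMeasure μ]
    (hμ : ∀ u : ℝ, charFun μ u = Complex.exp ((t : ℂ) *
        (((-(u ^ 2 * σ ^ 2) / 2 : ℝ) : ℂ) + Phi η u))) :
    wasserstein p μ (gaussianReal 0 (Real.toNNReal ((Real.sqrt t * Real.sqrt (σ ^ 2 + s)) ^ 2))) ≤
      ENNReal.ofReal (3 * (Real.sqrt t * Real.sqrt s)) := by
  obtain ⟨J, hJp, hJ⟩ := ex_J (ENNReal.ofReal t • η) (h2.smul_measure ENNReal.ofReal_ne_top)
  have eJ : ∀ u, ∫ x, lkIntegrandC u x ∂(ENNReal.ofReal t • η) = t * Phi η u := by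
    intro u
    rw [integral_smul_measure, ENNReal.toReal_ofReal ht.le, Complex.real_smul, Phi]
  have eg : μ = gaussianReal 0 (Real.toNNReal ((Real.sqrt t * σ) ^ 2)) ∗ J := by
    apply Measure.ext_of_charFun
    ext u
    rw [charFun_conv, charFun_gaussianReal, hJ, hμ, eJ, ← Complex.exp_add]
    congr 1
    rw [Real.coe_toNNReal _ (sq_nonneg _), mul_pow, Real.sq_sqrt ht.le]
    push_cast; ring
  have hJ2 : ∫⁻ x, ENNReal.ofReal (x ^ 2) ∂J ≤ ENNReal.ofReal (4 * (t * s)) := by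
    refine second_moment J (t * s) (fun u => ∫ x, lkIntegrandC u x ∂(ENNReal.ofReal t • η)) (fun u => ?_) hJ
    rw [eJ, norm_mul, Complex.norm_real, Real.norm_of_nonneg ht.le]
    have := norm_int_lk_le h2 u
    rw [← hs] at this
    calc _ ≤ t * (u ^ 2 * s) := by gcongr; exact this
      _ = _ := by ring
  have w1 : wasserstein p μ (gaussianReal 0 (Real.toNNReal ((Real.sqrt t * σ) ^ 2))) ≤
      ENNReal.ofReal (2 * (Real.sqrt t * Real.sqrt s)) := by
    refine (W_symm _ _ _).trans ?_
    have hW := W_conv (p := p) (gaussianReal 0 (Real.toNNReal ((Real.sqrt t * σ) ^ 2))) J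
    rw [← eg] at hW
    refine hW.trans ?_
    refine (lp_le_l2 hp1 hp2 J measurable_id).trans ?_
    refine (ENNReal.rpow_le_rpow hJ2 (by norm_num)).trans (le_of_eq ?_)
    rw [ENNReal.ofReal_rpow_of_nonneg (by positivity) (by norm_num), ← Real.sqrt_eq_rpow,
      show 4 * (t * s) = 2 ^ 2 * (t * s) by ring, Real.sqrt_mul (by positivity), Real.sqrt_sq (by norm_num),
      Real.sqrt_mul ht.le]
  refine (W_triangle hp1 _ (gaussianReal 0 (Real.toNNReal ((Real.sqrt t * σ) ^ 2))) _).trans ?_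
  rw [show 3 * (Real.sqrt t * Real.sqrt s) = 2 * (Real.sqrt t * Real.sqrt s) + Real.sqrt t * Real.sqrt s by ring,
    ENNReal.ofReal_add (by positivity) (by positivity)]
  refine add_le_add w1 ((W_gauss hp1 hp2 _ _).trans (ENNReal.ofReal_le_ofReal ?_))
  have q1 : σ ≤ Real.sqrt (σ ^ 2 + s) := Real.le_sqrt_of_sq_le (by linarith)
  have q2 : Real.sqrt (σ ^ 2 + s) ≤ σ + Real.sqrt s := by
    apply Real.sqrt_le_iff.2
    refine ⟨by positivity, ?_⟩
    have := Real.sq_sqrt hs0.le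
    nlinarith [mul_nonneg hσ (Real.sqrt_nonneg s)]
  rw [← mul_sub, abs_mul, abs_of_nonneg (Real.sqrt_nonneg t), abs_sub_comm, abs_of_nonneg (by linarith)]
  gcongr
  linarith

theorem single (p : ℝ) (hp1 : 1 ≤ p) (hp2 : p ≤ 2) : ∃ C > (0 : ℝ), ∀ (η : Measure ℝ),
    Integrable (fun x => x ^ 2) η → (∀ᵐ x ∂η, |x| ≤ 1) → ∀ s t σ : ℝ,
    s = ∫ x, x ^ 2 ∂η → 0 < s → 0 < t → 0 ≤ σ →
    ∀ (μ : Measure ℝ) [IsProbabilityMeasure μ],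
    (∀ u : ℝ, charFun μ u = Complex.exp ((t : ℂ) *
        (((-(u ^ 2 * σ ^ 2) / 2 : ℝ) : ℂ) + Phi η u))) →
    wasserstein p μ (gaussianReal 0 (Real.toNNReal ((Real.sqrt t * Real.sqrt (σ ^ 2 + s)) ^ 2))) ≤
      ENNReal.ofReal (C * min (Real.sqrt t * Real.sqrt s)
        (((∫ x, |x| ^ (p + 2) ∂η) / s) ^ (1 / p))) := by
  obtain ⟨C1, hC1, H1⟩ := core p 96 hp1 hp2 (by norm_num)
  obtain ⟨C2, hC2, H2⟩ := ex_Y p hp1 hp2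
  refine ⟨3 + 2 * Real.pi * (C1 + C2), by positivity, ?_⟩
  intro η h2 h1 s t σ hs hs0 ht hσ μ _ hμ
  set D := ((∫ x, |x| ^ (p + 2) ∂η) / s) ^ (1 / p) with hDdef
  have hP0 : 0 < ∫ x, |x| ^ (p + 2) ∂η := by
    have h0 : 0 ≤ ∫ x, |x| ^ (p + 2) ∂η := integral_nonneg fun x => by positivity
    refine lt_of_le_of_ne h0 fun h => ?_
    have := (integral_eq_zero_iff_of_nonneg (fun x => by positivity)
      (integrable_rpow h2 h1 (by linarith))).1 h.symm
    have hz : ∫ x, x ^ 2 ∂η = 0 := by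
      rw [integral_eq_zero_iff_of_nonneg (fun x => by positivity) h2]
      filter_upwards [this] with x hx
      have := (Real.rpow_eq_zero (abs_nonneg x) (by linarith)).1 hx
      simp [abs_eq_zero.1 this]
    linarith
  have hD : 0 < D := by positivity
  have hP : ∫ x, |x| ^ (p + 2) ∂η = D ^ p * s := by
    rw [hDdef, ← Real.rpow_mul (by positivity), one_div_mul_cancel (by linarith), Real.rpow_one]
    field_simp
  have hpi := Real.pi_pos
  rcases le_total (Real.sqrt t * Real.sqrt s) D with hcase | hcase
  · rw [min_eq_left hcase]
    refine (W_small h2 hp1 hp2 hs hs0 ht hσ μ hμ).trans (ENNReal.ofReal_le_ofReal ?_)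
    gcongr
    have : 0 ≤ 2 * Real.pi * (C1 + C2) := by positivity
    linarith
  · rw [min_eq_right hcase]
    have hpos : 0 < σ ^ 2 + s := by positivity
    set κ := (Real.sqrt t * Real.sqrt (σ ^ 2 + s))⁻¹ with hκd
    have hκ : 0 < κ := by positivity
    have hS : κ ^ 2 * (t * (σ ^ 2 + s)) = 1 := by
      have : t * (σ ^ 2 + s) = (Real.sqrt t * Real.sqrt (σ ^ 2 + s)) ^ 2 := by
        rw [mul_pow, Real.sq_sqrt ht.le, Real.sq_sqrt hpos.le]
      rw [this, hκd, ← mul_pow, inv_mul_cancel₀ (by positivity), one_pow]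
    have hδ1 : κ * D ≤ 1 := by
      rw [hκd, inv_mul_le_iff₀ (by positivity), mul_one]
      refine hcase.trans ?_
      gcongr
      nlinarith [sq_nonneg σ]
    have hc : |t * κ ^ 3 * ∫ x, x ^ 3 ∂η| ≤ κ * D := by
      have h3 := third_le h2 h1 hp1 hD hs hP
      rw [abs_mul, abs_of_pos (by positivity)]
      have tks : t * κ ^ 2 * s ≤ 1 := by
        nlinarith [mul_nonneg (mul_nonneg (sq_nonneg κ) ht.le) (sq_nonneg σ)]
      calc _ ≤ t * κ ^ 3 * (D * s) := by gcongr
        _ = (t * κ ^ 2 * s) * (κ * D) := by ring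
        _ ≤ 1 * (κ * D) := by gcongr
        _ = _ := one_mul _
    obtain ⟨Y, Y1, Y2, Y3, ν, hν, hYa, hYc, hYW⟩ := H2 _ _ (by positivity) hδ1 hc
    set μ' := μ.map (fun x => (κ / (2 * Real.pi)) * x) with hμ'
    have hm' : IsProbabilityMeasure μ' := Measure.isProbabilityMeasure_map (by fun_prop)
    have hμc : ∀ v, charFun μ' (2 * Real.pi * v) = Complex.exp
        ((t : ℂ) * (((-((κ * v) ^ 2 * σ ^ 2) / 2 : ℝ) : ℂ) + Phi η (κ * v))) := by
      intro v
      rw [← hμ, charFun_eq, charFun_eq, hμ', integral_map (by fun_prop) (by fun_prop)]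
      congr 1; ext x
      congr 3
      field_simp
    have W1 := H1 _ _ (by positivity) hδ1 hc _ _ _ _ _ _ _ _
      (levy_adm h2 h1 hp1 hp2 hD hs hs0 ht hκ hS hP) hYa μ' ν hμc hYc
    have W2 : wasserstein p μ' ((gaussianReal 0 1).map fun x => (2 * Real.pi)⁻¹ * x) ≤
        ENNReal.ofReal ((C1 + C2) * (κ * D)) := by
      have : IsProbabilityMeasure ((gaussianReal 0 1).map fun x => (2 * Real.pi)⁻¹ * x) :=
        Measure.isProbabilityMeasure_map (by fun_prop)
      refine (W_triangle hp1 _ ν _).trans ?_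
      rw [add_mul, ENNReal.ofReal_add (by positivity) (by positivity)]
      exact add_le_add W1 hYW
    have hc0 : 2 * Real.pi * κ⁻¹ ≠ 0 := by positivity
    have W3 := W_scale hp1 hc0 μ' ((gaussianReal 0 1).map fun x => (2 * Real.pi)⁻¹ * x)
    have e1 : μ'.map (2 * Real.pi * κ⁻¹ * ·) = μ := by
      rw [hμ', Measure.map_map (by fun_prop) (by fun_prop)]
      convert! Measure.map_id using 2
      ext x; simp; field_simp
    have e2 : ((gaussianReal 0 1).map fun x => (2 * Real.pi)⁻¹ * x).map (2 * Real.pi * κ⁻¹ * ·) =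
        gaussianReal 0 (Real.toNNReal ((Real.sqrt t * Real.sqrt (σ ^ 2 + s)) ^ 2)) := by
      rw [Measure.map_map (by fun_prop) (by fun_prop)]
      have : ((2 * Real.pi * κ⁻¹ * ·) ∘ fun x => (2 * Real.pi)⁻¹ * x) = fun x : ℝ => κ⁻¹ * x := by
        ext x; simp only [Function.comp]; field_simp
      rw [this, gaussianReal_map_const_mul, mul_zero, mul_one, hκd, inv_inv]
      congr 1
      ext
      simp
      try positivity
    rw [e1, e2] at W3
    refine W3.trans ((mul_le_mul_right W2 _).trans ?_)
    rw [← ENNReal.ofReal_mul (abs_nonneg _), abs_of_pos (by positivity)]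
    apply ENNReal.ofReal_le_ofReal
    have : 2 * Real.pi * κ⁻¹ * ((C1 + C2) * (κ * D)) = 2 * Real.pi * (C1 + C2) * D := by field_simp
    rw [this]
    gcongr
    linarith

end Part9


lemma meas_small (ε : ℝ) : MeasurableSet {x : ℝ | |x| ≤ ε} :=
  measurableSet_le (by fun_prop) measurable_const

lemma ae_le_one {ε : ℝ} (hε : ε ≤ 1) {ν : Measure ℝ} :
    ∀ᵐ x ∂(ν.restrict {x | |x| ≤ ε}), |x| ≤ 1 := by
  filter_upwards [ae_restrict_mem (meas_small ε)] with x hx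
  exact le_trans hx hε

lemma int_sq {ε : ℝ} (hε : ε ≤ 1) {ν : Measure ℝ}
    (h : ∫⁻ x, ENNReal.ofReal (min (x ^ 2) 1) ∂ν ≠ ⊤) :
    Integrable (fun x => x ^ 2) (ν.restrict {x | |x| ≤ ε}) := by
  have h1 : Integrable (fun x : ℝ => min (x ^ 2) 1) ν := by
    rw [← lintegral_ofReal_ne_top_iff_integrable (by fun_prop)
      (Filter.Eventually.of_forall fun x => by positivity)]
    exact h
  refine (h1.restrict (s := {x | |x| ≤ ε})).congr ?_
  filter_upwards [ae_le_one hε (ν := ν)] with x hx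
  exact min_eq_left ((sq_le_one_iff_abs_le_one x).2 hx)

/-- Wasserstein distance between the marginals at time `t` of two Lévy
processes consisting of a Gaussian part and compensated jumps of size at most `ε`. -/
theorem statement5 (p : ℝ) (hp1 : 1 ≤ p) (hp2 : p ≤ 2) :
    ∃ C > (0 : ℝ), ∀ (ε : ℝ), 0 < ε → ε ≤ 1 →
      ∀ (ν1 ν2 : Measure ℝ),
      ν1 {0} = 0 → ν2 {0} = 0 →
      (∫⁻ x, ENNReal.ofReal (min (x ^ 2) 1) ∂ν1 ≠ ⊤) →
      (∫⁻ x, ENNReal.ofReal (min (x ^ 2) 1) ∂ν2 ≠ ⊤) →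
      ∀ s1 s2 : ℝ,
      s1 = ∫ x in {x : ℝ | |x| ≤ ε}, x ^ 2 ∂ν1 →
      s2 = ∫ x in {x : ℝ | |x| ≤ ε}, x ^ 2 ∂ν2 →
      0 < s1 → 0 < s2 →
      ∀ σ1 σ2 : ℝ, 0 ≤ σ1 → 0 ≤ σ2 →
      ∀ t : ℝ, 0 < t →
      ∀ μt1 μt2 : Measure ℝ, IsProbabilityMeasure μt1 → IsProbabilityMeasure μt2 →
      (∀ u : ℝ, charFn μt1 u = Complex.exp ((t : ℂ) *
        (((-(u ^ 2 * σ1 ^ 2) / 2 : ℝ) : ℂ) + ∫ x in {x : ℝ | |x| ≤ ε}, lkIntegrandC u x ∂ν1))) →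
      (∀ u : ℝ, charFn μt2 u = Complex.exp ((t : ℂ) *
        (((-(u ^ 2 * σ2 ^ 2) / 2 : ℝ) : ℂ) + ∫ x in {x : ℝ | |x| ≤ ε}, lkIntegrandC u x ∂ν2))) →
      wasserstein p μt1 μt2
        ≤ ENNReal.ofReal (C * min (Real.sqrt t * Real.sqrt s1)
              (((∫ x in {x : ℝ | |x| ≤ ε}, |x| ^ (p + 2) ∂ν1) / s1) ^ (1 / p)))
          + ENNReal.ofReal (C * min (Real.sqrt t * Real.sqrt s2)
              (((∫ x in {x : ℝ | |x| ≤ ε}, |x| ^ (p + 2) ∂ν2) / s2) ^ (1 / p)))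
          + ENNReal.ofReal (Real.sqrt t * |Real.sqrt (σ1 ^ 2 + s1) - Real.sqrt (σ2 ^ 2 + s2)|) := by
  obtain ⟨C, hC, h⟩ := single p hp1 hp2
  refine ⟨C, hC, ?_⟩
  intro ε hε hε1 ν1 ν2 _ _ hl1 hl2 s1 s2 hs1 hs2 hs1p hs2p σ1 σ2 hσ1 hσ2 t ht μ1 μ2 hμ1 hμ2 hc1 hc2
  have A1 := h (ν1.restrict {x | |x| ≤ ε}) (int_sq hε1 hl1) (ae_le_one hε1) s1 t σ1 hs1 hs1p ht hσ1 μ1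
    (fun u => by rw [charFun_eq]; exact hc1 u)
  have A2 := h (ν2.restrict {x | |x| ≤ ε}) (int_sq hε1 hl2) (ae_le_one hε1) s2 t σ2 hs2 hs2p ht hσ2 μ2
    (fun u => by rw [charFun_eq]; exact hc2 u)
  have G := W_gauss hp1 hp2 (Real.sqrt t * Real.sqrt (σ1 ^ 2 + s1)) (Real.sqrt t * Real.sqrt (σ2 ^ 2 + s2))
  rw [← mul_sub, abs_mul, abs_of_nonneg (Real.sqrt_nonneg t)] at G
  refine (W_triangle hp1 _ _ _).trans ((add_le_add A1 ((W_triangle hp1 _ _ _).trans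
    (add_le_add G ((W_symm _ _ _).trans A2)))).trans (le_of_eq ?_))
  rw [add_assoc]
  congr 1
  rw [add_comm]
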